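/- arXiv:0811.1667 — 4 statements merged into one kernel-verified Lean document; each statement's English description precedes it below -/
import Mathlib

section
/- Let σ ∈ [0,1], κ ≥ 0, l, m, w ∈ ℝ, N ∈ ℕ*. Let s ∈ S_σ^{l,m}(ℝ^{2n}, M_N(ℂ)), let m̃ ∈ H_{σ,κ}^{w}(ℝ^n) be such that there exist C, c, r > 0 with c⟨x⟩⟨ζ⟩^{-r} ≤ ⟨m̃(x,ζ)⟩ ≤ C⟨x⟩⟨ζ⟩^{r} for all (x,ζ) in case σ ≠ 0, and let P ∈ E_{σ,κ}^{0}(M_n(ℝ)) be such that ⟨P_{x,ζ}(ϑ)⟩ ≥ c⟨ϑ⟩ for all (x,ζ,ϑ) ∈ ℝ^{3n}. Then the function (x,ζ,ϑ) ↦ s( m̃(x,ζ), P_{x,ζ}(ϑ) ) belongs to the amplitude space Π_{σ, κ+|σr-κ+w|}^{l, σr|l|, m}(ℝ^{3n}, M_N(ℂ)). -/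
open MeasureTheory
open scoped BigOperators

noncomputable section

/-- Japanese bracket `⟨v⟩ = (1 + ‖v‖²)^(1/2)` (with the Euclidean norm). -/
def jb {n : ℕ} (v : Fin n → ℝ) : ℝ := Real.sqrt (1 + ∑ i, (v i) ^ 2)

/-- Japanese bracket of a pair of vectors, `⟨(x,y)⟩`. -/
def jb2 {n m : ℕ} (x : Fin n → ℝ) (y : Fin m → ℝ) : ℝ :=
  Real.sqrt (1 + ∑ i, (x i) ^ 2 + ∑ j, (y j) ^ 2)

/-- Euclidean inner product `⟨ϑ, ζ⟩`. -/
def ip {n : ℕ} (ϑ ζ : Fin n → ℝ) : ℝ := ∑ i, ϑ i * ζ i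

/-- Partial derivative in the `i`-th coordinate direction. -/
def pd {n : ℕ} {E : Type*} [NormedAddCommGroup E] [NormedSpace ℝ E]
    (i : Fin n) (f : (Fin n → ℝ) → E) : (Fin n → ℝ) → E :=
  fun x => fderiv ℝ f x (Pi.single i 1)

/-- Iterated partial derivative `∂^ν` along the multi-index `ν`. -/
def pdm {n : ℕ} {E : Type*} [NormedAddCommGroup E] [NormedSpace ℝ E]
    (ν : Fin n → ℕ) (f : (Fin n → ℝ) → E) : (Fin n → ℝ) → E :=
  (List.finRange n).foldr (fun i g => (pd i)^[ν i] g) f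

/-- Mixed partial derivative `∂_x^α ∂_y^β` of a function of two vector variables. -/
def pdm2 {n m : ℕ} {E : Type*} [NormedAddCommGroup E] [NormedSpace ℝ E]
    (α : Fin n → ℕ) (β : Fin m → ℕ) (f : (Fin n → ℝ) → (Fin m → ℝ) → E) :
    (Fin n → ℝ) → (Fin m → ℝ) → E :=
  fun x y => pdm α (fun x' => pdm β (f x') y) x

/-- Mixed partial derivative `∂_x^α ∂_y^β ∂_z^γ` of a function of three vector variables. -/
def pdm3 {n m k : ℕ} {E : Type*} [NormedAddCommGroup E] [NormedSpace ℝ E]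
    (α : Fin n → ℕ) (β : Fin m → ℕ) (γ : Fin k → ℕ)
    (f : (Fin n → ℝ) → (Fin m → ℝ) → (Fin k → ℝ) → E) :
    (Fin n → ℝ) → (Fin m → ℝ) → (Fin k → ℝ) → E :=
  fun x y z => pdm α (fun x' => pdm β (fun y' => pdm γ (f x' y') z) y) x

/-- Length `|ν|` of a multi-index. -/
def msize {n : ℕ} (ν : Fin n → ℕ) : ℕ := ∑ i, ν i

/-- The class `G_σ(ℝ^n, E)`: smooth functions whose `ν`-th derivative is
`O(⟨v⟩^{-σ(|ν|-1)})` for every `ν ≠ 0`. -/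
def GsigmaCl {n : ℕ} {E : Type*} [NormedAddCommGroup E] [NormedSpace ℝ E]
    (σ : ℝ) (f : (Fin n → ℝ) → E) : Prop :=
  ContDiff ℝ (⊤ : ℕ∞) f ∧ ∀ ν : Fin n → ℕ, ν ≠ 0 → ∃ C > 0, ∀ v,
    ‖pdm ν f v‖ ≤ C * jb v ^ (-(σ * ((msize ν : ℝ) - 1)))

/-- The class `S_σ(ℝ^n)`: smooth real functions whose `ν`-th derivative is
`O(⟨v⟩^{-σ|ν|})` for every `ν`. -/
def SsigmaCl {n : ℕ} (σ : ℝ) (f : (Fin n → ℝ) → ℝ) : Prop :=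
  ContDiff ℝ (⊤ : ℕ∞) f ∧ ∀ ν : Fin n → ℕ, ∃ C > 0, ∀ v,
    |pdm ν f v| ≤ C * jb v ^ (-(σ * (msize ν : ℝ)))

/-- `G_σ^×(ℝ^p)`: diffeomorphisms `g` of `ℝ^p` with `g` and `g⁻¹` in `G_σ`. -/
def GsigmaX {p : ℕ} (σ : ℝ) (g : (Fin p → ℝ) → (Fin p → ℝ)) : Prop :=
  ∃ h : (Fin p → ℝ) → (Fin p → ℝ),
    Function.LeftInverse h g ∧ Function.RightInverse h g ∧ GsigmaCl σ g ∧ GsigmaCl σ h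

/-- The class `O_M(ℝ^n, E)`: smooth functions with polynomially bounded derivatives. -/
def OMCl {n : ℕ} {E : Type*} [NormedAddCommGroup E] [NormedSpace ℝ E]
    (f : (Fin n → ℝ) → E) : Prop :=
  ContDiff ℝ (⊤ : ℕ∞) f ∧ ∀ ν : Fin n → ℕ, ∃ C > 0, ∃ k : ℕ, ∀ v,
    ‖pdm ν f v‖ ≤ C * jb v ^ (k : ℝ)

/-- `O_M^×(ℝ^p, ℝ^p)`: diffeomorphisms `g` of `ℝ^p` with `g` and `g⁻¹` in `O_M`. -/
def OMX {p : ℕ} (g : (Fin p → ℝ) → (Fin p → ℝ)) : Prop :=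
  ∃ h : (Fin p → ℝ) → (Fin p → ℝ),
    Function.LeftInverse h g ∧ Function.RightInverse h g ∧ OMCl g ∧ OMCl h

/-- The symbol space `S_σ^{l,m}(ℝ^{2n}, E)`. -/
def Ssym {n : ℕ} {E : Type*} [NormedAddCommGroup E] [NormedSpace ℝ E]
    (σ l m : ℝ) (a : (Fin n → ℝ) → (Fin n → ℝ) → E) : Prop :=
  ContDiff ℝ (⊤ : ℕ∞) (fun q : (Fin n → ℝ) × (Fin n → ℝ) => a q.1 q.2) ∧
  ∀ α β : Fin n → ℕ, ∃ C > 0, ∀ x ϑ,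
    ‖pdm2 α β a x ϑ‖ ≤ C * jb x ^ (σ * (l - (msize α : ℝ))) * jb ϑ ^ (m - (msize β : ℝ))

/-- The amplitude space `Π_{σ,κ}^{l,w,m}(ℝ^{3n}, E)`. -/
def Amp {n : ℕ} {E : Type*} [NormedAddCommGroup E] [NormedSpace ℝ E]
    (σ κ l w m : ℝ) (a : (Fin n → ℝ) → (Fin n → ℝ) → (Fin n → ℝ) → E) : Prop :=
  ContDiff ℝ (⊤ : ℕ∞)
    (fun q : ((Fin n → ℝ) × (Fin n → ℝ)) × (Fin n → ℝ) => a q.1.1 q.1.2 q.2) ∧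
  ∀ α β γ : Fin n → ℕ, ∃ C > 0, ∀ x ζ ϑ,
    ‖pdm3 α β γ a x ζ ϑ‖ ≤
      C * jb x ^ (σ * (l - ((msize α + msize β : ℕ) : ℝ))) *
        jb ζ ^ (w + κ * ((msize α + msize β : ℕ) : ℝ)) * jb ϑ ^ (m - (msize γ : ℝ))

/-- The space `H_{σ,κ}^{w}(E)` of smooth functions on `ℝ^{2n}`. -/
def Hsp {n : ℕ} {F : Type*} [NormedAddCommGroup F] [NormedSpace ℝ F]
    (σ κ w : ℝ) (g : (Fin n → ℝ) → (Fin n → ℝ) → F) : Prop :=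
  ContDiff ℝ (⊤ : ℕ∞) (fun q : (Fin n → ℝ) × (Fin n → ℝ) => g q.1 q.2) ∧
  ∀ α β : Fin n → ℕ, ¬(α = 0 ∧ β = 0) → ∃ C > 0, ∀ x ζ,
    ‖pdm2 α β g x ζ‖ ≤ C * jb x ^ (-(σ * (((msize α + msize β : ℕ) : ℝ) - 1))) *
      jb ζ ^ (w + κ * (((msize α + msize β : ℕ) : ℝ) - 1))

/-- The space `E_{σ,κ}^{w}(E)` of smooth functions on `ℝ^{2n}`. -/
def Esp {n : ℕ} {F : Type*} [NormedAddCommGroup F] [NormedSpace ℝ F]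
    (σ κ w : ℝ) (g : (Fin n → ℝ) → (Fin n → ℝ) → F) : Prop :=
  ContDiff ℝ (⊤ : ℕ∞) (fun q : (Fin n → ℝ) × (Fin n → ℝ) => g q.1 q.2) ∧
  ∀ α β : Fin n → ℕ, ∃ C > 0, ∀ x ζ,
    ‖pdm2 α β g x ζ‖ ≤ C * jb x ^ (-(σ * ((msize α + msize β : ℕ) : ℝ))) *
      jb ζ ^ (w + κ * ((msize α + msize β : ℕ) : ℝ))

/-- Jacobian determinant of a map `ℝ^p → ℝ^p`. -/
def Jdet {p : ℕ} (g : (Fin p → ℝ) → (Fin p → ℝ)) : (Fin p → ℝ) → ℝ :=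
  fun v => LinearMap.det (fderiv ℝ g v).toLinearMap

/-- The seminorm `q_{p,(α,β)}(K) = sup ⟨(x,y)⟩^p |∂^{(α,β)} K (x,y)|`. -/
def qSem {n : ℕ} (p : ℕ) (α β : Fin n → ℕ)
    (K : (Fin n → ℝ) → (Fin n → ℝ) → ℂ) : ℝ :=
  ⨆ q : (Fin n → ℝ) × (Fin n → ℝ), jb2 q.1 q.2 ^ p * ‖pdm2 α β K q.1 q.2‖

/-- Mixed partial derivative `∂_r^α ∂_θ^β` of a function of two real variables. -/
def pd2 (α β : ℕ) (F : ℝ → ℝ → ℝ) (r θ : ℝ) : ℝ :=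
  iteratedDeriv α (fun r' => iteratedDeriv β (fun θ' => F r' θ') θ) r

/-- Smooth real function on `ℝ` with all derivatives bounded. -/
def BddSmooth (a : ℝ → ℝ) : Prop :=
  ContDiff ℝ (⊤ : ℕ∞) a ∧ ∀ k : ℕ, ∃ C : ℝ, ∀ t, |iteratedDeriv k a t| ≤ C

/-- Inverse hyperbolic cosine, `arcosh x = log (x + √(x²-1))`. -/
def arcosh (x : ℝ) : ℝ := Real.log (x + Real.sqrt (x ^ 2 - 1))


section Gen

variable {V W E G J K : Type*} [NormedAddCommGroup V] [NormedSpace ℝ V]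
  [NormedAddCommGroup W] [NormedSpace ℝ W]
  [NormedAddCommGroup E] [NormedSpace ℝ E] [NormedAddCommGroup G] [NormedSpace ℝ G]

/-- Directional derivative along the `j`-th vector of a family. -/
def dd (e : J → V) (j : J) (f : V → E) : V → E := fun q => fderiv ℝ f q (e j)

/-- Iterated directional derivatives along a word. -/
def Dw (e : J → V) : List J → (V → E) → (V → E)
  | [], f => f
  | j :: L, f => Dw e L (dd e j f)

lemma dd_smooth (e : J → V) (j : J) {f : V → E} (hf : ContDiff ℝ (⊤ : ℕ∞) f) :
    ContDiff ℝ (⊤ : ℕ∞) (dd e j f) := by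
  unfold dd
  exact (hf.fderiv_right (m := ((⊤ : ℕ∞) : WithTop ℕ∞)) (by norm_cast)).clm_apply contDiff_const

lemma sm_diff {f : V → E} (hf : ContDiff ℝ (⊤ : ℕ∞) f) : Differentiable ℝ f :=
  hf.differentiable (by simp)

lemma Dw_smooth (e : J → V) (L : List J) {f : V → E} (hf : ContDiff ℝ (⊤ : ℕ∞) f) :
    ContDiff ℝ (⊤ : ℕ∞) (Dw e L f) := by
  induction L generalizing f with
  | nil => exact hf
  | cons j L ih => exact ih (dd_smooth e j hf)

lemma Dw_append (e : J → V) (L M : List J) (f : V → E) :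
    Dw e (L ++ M) f = Dw e M (Dw e L f) := by
  induction L generalizing f with
  | nil => rfl
  | cons j L ih => exact ih _

lemma dd_comm (e : J → V) (i j : J) {f : V → E} (hf : ContDiff ℝ (⊤ : ℕ∞) f) :
    dd e i (dd e j f) = dd e j (dd e i f) := by
  funext q
  have hd : Differentiable ℝ (fderiv ℝ f) :=
    (hf.fderiv_right (m := ((⊤ : ℕ∞) : WithTop ℕ∞)) (by norm_cast)).differentiable (by simp)
  have key : ∀ a b : J, dd e a (dd e b f) q = fderiv ℝ (fderiv ℝ f) q (e a) (e b) := by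
    intro a b
    unfold dd
    rw [fderiv_clm_apply (hd q) (differentiableAt_const _)]
    simp
  rw [key, key]
  have hs : IsSymmSndFDerivAt ℝ f q := by
    apply ContDiffAt.isSymmSndFDerivAt (n := ((⊤ : ℕ∞) : WithTop ℕ∞)) hf.contDiffAt
    simp only [minSmoothness_of_isRCLikeNormedField]
    exact WithTop.coe_le_coe.mpr (le_top : (2 : ℕ∞) ≤ ⊤)
  exact hs (e i) (e j)

lemma Dw_perm (e : J → V) {L M : List J} (h : L.Perm M) :
    ∀ {f : V → E}, ContDiff ℝ (⊤ : ℕ∞) f → Dw e L f = Dw e M f := by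
  induction h with
  | nil => intros; rfl
  | cons x _ ih => intro f hf; exact ih (dd_smooth e x hf)
  | swap x y l => intro f hf; simp only [Dw]; rw [dd_comm e x y hf]
  | trans _ _ ih1 ih2 => intro f hf; rw [ih1 hf, ih2 hf]

lemma Dw_slice (e : J → V) (e' : K → W) (ι : J → K) (A : V → W) (T : V →L[ℝ] W)
    (hA : ∀ v, HasFDerivAt A T v) (hT : ∀ j, T (e j) = e' (ι j)) (L : List J) :
    ∀ {F : W → E}, ContDiff ℝ (⊤ : ℕ∞) F → ∀ v,
      Dw e L (fun v => F (A v)) v = Dw e' (L.map ι) F (A v) := by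
  induction L with
  | nil => intros; rfl
  | cons j L ih =>
    intro F hF v
    have h1 : dd e j (fun v => F (A v)) = fun v => dd e' (ι j) F (A v) := by
      funext v
      unfold dd
      have := ((sm_diff hF (A v)).hasFDerivAt.comp v (hA v)).fderiv
      have h2 : fderiv ℝ (fun v => F (A v)) v = (fderiv ℝ F (A v)).comp T := this
      rw [h2]; simp [hT]
    simp only [Dw, List.map_cons]
    rw [h1]
    exact ih (dd_smooth e' (ι j) hF) v

/-- Symbol-type estimates up to order `k`. -/
def Ob (e : J → V) (τ : J → V → ℝ) : ℕ → (V → ℝ) → (V → E) → Prop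
  | 0, ρ, f => ∃ C, 0 ≤ C ∧ ∀ q, ‖f q‖ ≤ C * ρ q
  | k + 1, ρ, f => (∃ C, 0 ≤ C ∧ ∀ q, ‖f q‖ ≤ C * ρ q) ∧
      ∀ j, Ob e τ k (fun q => ρ q * τ j q) (dd e j f)

variable {e : J → V} {τ : J → V → ℝ}

lemma Ob.base {k : ℕ} {ρ : V → ℝ} {f : V → E} (h : Ob e τ k ρ f) :
    ∃ C, 0 ≤ C ∧ ∀ q, ‖f q‖ ≤ C * ρ q := by
  cases k with
  | zero => exact h
  | succ k => exact h.1

lemma Ob.pred {k : ℕ} : ∀ {ρ : V → ℝ} {f : V → E}, Ob e τ (k + 1) ρ f → Ob e τ k ρ f := by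
  induction k with
  | zero => intro ρ f h; exact h.1
  | succ k ih => intro ρ f h; exact ⟨h.1, fun j => ih (h.2 j)⟩

lemma Ob.mono (hτ : ∀ j q, 0 ≤ τ j q) {k : ℕ} : ∀ {ρ ρ' : V → ℝ} {f : V → E},
    (∃ C, 0 ≤ C ∧ ∀ q, ρ q ≤ C * ρ' q) → Ob e τ k ρ f → Ob e τ k ρ' f := by
  have base : ∀ {ρ ρ' : V → ℝ} {f : V → E}, (∃ C, 0 ≤ C ∧ ∀ q, ρ q ≤ C * ρ' q) →
      (∃ C, 0 ≤ C ∧ ∀ q, ‖f q‖ ≤ C * ρ q) → (∃ C, 0 ≤ C ∧ ∀ q, ‖f q‖ ≤ C * ρ' q) := by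
    rintro ρ ρ' f ⟨C, hC, h⟩ ⟨C', hC', h'⟩
    refine ⟨C' * C, mul_nonneg hC' hC, fun q => (h' q).trans ?_⟩
    rw [mul_assoc]
    exact mul_le_mul_of_nonneg_left (h q) hC'
  induction k with
  | zero => intro ρ ρ' f h h'; exact base h h'
  | succ k ih =>
    intro ρ ρ' f h h'
    refine ⟨base h h'.1, fun j => ih ?_ (h'.2 j)⟩
    obtain ⟨C, hC, h⟩ := h
    refine ⟨C, hC, fun q => ?_⟩
    rw [← mul_assoc]
    exact mul_le_mul_of_nonneg_right (h q) (hτ j q)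

lemma Ob.zero {k : ℕ} : ∀ {ρ : V → ℝ}, Ob e τ k ρ (fun _ => (0 : E)) := by
  have base : ∀ {ρ : V → ℝ}, (∃ C, 0 ≤ C ∧ ∀ q, ‖(0 : E)‖ ≤ C * ρ q) := by
    intro ρ; exact ⟨0, le_rfl, fun q => by simp⟩
  induction k with
  | zero => intro ρ; exact base
  | succ k ih =>
    intro ρ
    refine ⟨base, fun j => ?_⟩
    have : dd e j (fun _ : V => (0 : E)) = fun _ => 0 := by
      funext q; simp [dd]
    rw [this]; exact ih

lemma Ob.add {k : ℕ} : ∀ {ρ : V → ℝ} {f g : V → E}, ContDiff ℝ (⊤ : ℕ∞) f →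
    ContDiff ℝ (⊤ : ℕ∞) g → Ob e τ k ρ f → Ob e τ k ρ g → Ob e τ k ρ (fun q => f q + g q) := by
  have base : ∀ {ρ : V → ℝ} {f g : V → E},
      (∃ C, 0 ≤ C ∧ ∀ q, ‖f q‖ ≤ C * ρ q) → (∃ C, 0 ≤ C ∧ ∀ q, ‖g q‖ ≤ C * ρ q) →
      (∃ C, 0 ≤ C ∧ ∀ q, ‖f q + g q‖ ≤ C * ρ q) := by
    rintro ρ f g ⟨C, hC, h⟩ ⟨C', hC', h'⟩
    refine ⟨C + C', add_nonneg hC hC', fun q => (norm_add_le _ _).trans ?_⟩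
    rw [add_mul]
    exact add_le_add (h q) (h' q)
  induction k with
  | zero => intro ρ f g _ _ h h'; exact base h h'
  | succ k ih =>
    intro ρ f g hf hg h h'
    refine ⟨base h.1 h'.1, fun j => ?_⟩
    have : dd e j (fun q => f q + g q) = fun q => dd e j f q + dd e j g q := by
      funext q
      unfold dd
      rw [fderiv_fun_add (sm_diff hf q) (sm_diff hg q)]; rfl
    rw [this]
    exact ih (dd_smooth e j hf) (dd_smooth e j hg) (h.2 j) (h'.2 j)

lemma Ob.sum {ι : Type*} (s : Finset ι) {k : ℕ} {ρ : V → ℝ} {f : ι → V → E}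
    (hf : ∀ i, ContDiff ℝ (⊤ : ℕ∞) (f i)) (h : ∀ i, Ob e τ k ρ (f i)) :
    Ob e τ k ρ (fun q => ∑ i ∈ s, f i q) := by
  classical
  induction s using Finset.induction_on with
  | empty => simpa using Ob.zero
  | insert a s ha ih =>
    simp only [Finset.sum_insert ha]
    exact Ob.add (hf a) (ContDiff.sum fun i _ => hf i) (h a) ih

lemma Ob.smul {k : ℕ} : ∀ {ρ ρ' : V → ℝ} {f : V → ℝ} {g : V → E}, ContDiff ℝ (⊤ : ℕ∞) f →
    ContDiff ℝ (⊤ : ℕ∞) g → Ob e τ k ρ f → Ob e τ k ρ' g →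
    Ob e τ k (fun q => ρ q * ρ' q) (fun q => f q • g q) := by
  have base : ∀ {ρ ρ' : V → ℝ} {f : V → ℝ} {g : V → E},
      (∃ C, 0 ≤ C ∧ ∀ q, ‖f q‖ ≤ C * ρ q) → (∃ C, 0 ≤ C ∧ ∀ q, ‖g q‖ ≤ C * ρ' q) →
      (∃ C, 0 ≤ C ∧ ∀ q, ‖f q • g q‖ ≤ C * (ρ q * ρ' q)) := by
    rintro ρ ρ' f g ⟨C, hC, h⟩ ⟨C', hC', h'⟩
    refine ⟨C * C', mul_nonneg hC hC', fun q => ?_⟩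
    rw [norm_smul, mul_mul_mul_comm]
    exact mul_le_mul (h q) (h' q) (norm_nonneg _) ((norm_nonneg _).trans (h q))
  induction k with
  | zero => intro ρ ρ' f g _ _ h h'; exact base h h'
  | succ k ih =>
    intro ρ ρ' f g hf hg h h'
    refine ⟨base h.1 h'.1, fun j => ?_⟩
    have : dd e j (fun q => f q • g q) =
        fun q => f q • dd e j g q + dd e j f q • g q := by
      funext q
      unfold dd
      rw [fderiv_fun_smul (sm_diff hf q) (sm_diff hg q)]
      simp
    rw [this]
    refine Ob.add (hf.smul (dd_smooth e j hg)) ((dd_smooth e j hf).smul hg) ?_ ?_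
    · have := ih hf (dd_smooth e j hg) h.pred (h'.2 j)
      convert this using 1
      funext q; ring
    · have := ih (dd_smooth e j hf) hg (h.2 j) h'.pred
      convert this using 1
      funext q; ring

lemma Ob.clm (T : E →L[ℝ] G) {k : ℕ} : ∀ {ρ : V → ℝ} {f : V → E}, ContDiff ℝ (⊤ : ℕ∞) f →
    Ob e τ k ρ f → Ob e τ k ρ (fun q => T (f q)) := by
  have base : ∀ {ρ : V → ℝ} {f : V → E},
      (∃ C, 0 ≤ C ∧ ∀ q, ‖f q‖ ≤ C * ρ q) →
      (∃ C, 0 ≤ C ∧ ∀ q, ‖T (f q)‖ ≤ C * ρ q) := by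
    rintro ρ f ⟨C, hC, h⟩
    refine ⟨‖T‖ * C, by positivity, fun q => (T.le_opNorm _).trans ?_⟩
    rw [mul_assoc]
    exact mul_le_mul_of_nonneg_left (h q) (norm_nonneg _)
  induction k with
  | zero => intro ρ f _ h; exact base h
  | succ k ih =>
    intro ρ f hf h
    refine ⟨base h.1, fun j => ?_⟩
    have : dd e j (fun q => T (f q)) = fun q => T (dd e j f q) := by
      funext q
      unfold dd
      have h2 : fderiv ℝ (fun v => T (f v)) q = T.comp (fderiv ℝ f q) :=
        (T.hasFDerivAt.comp q (sm_diff hf q).hasFDerivAt).fderiv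
      rw [h2]; rfl
    rw [this]
    exact ih (dd_smooth e j hf) (h.2 j)

/-- Pull-back along the first projection. -/
lemma Ob.fst {e' : K → V × W} {τ' : K → V × W → ℝ}
    (hcase : ∀ d : K, (∃ j, (e' d).1 = e j ∧ ∀ q, τ j q.1 = τ' d q) ∨ (e' d).1 = 0)
    {k : ℕ} : ∀ {ρ : V → ℝ} {f : V → E}, ContDiff ℝ (⊤ : ℕ∞) f →
    Ob e τ k ρ f → Ob e' τ' k (fun q => ρ q.1) (fun q => f q.1) := by
  have base : ∀ {ρ : V → ℝ} {f : V → E},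
      (∃ C, 0 ≤ C ∧ ∀ q, ‖f q‖ ≤ C * ρ q) →
      (∃ C, 0 ≤ C ∧ ∀ q : V × W, ‖f q.1‖ ≤ C * ρ q.1) := by
    rintro ρ f ⟨C, hC, h⟩
    exact ⟨C, hC, fun q => h q.1⟩
  induction k with
  | zero => intro ρ f _ h; exact base h
  | succ k ih =>
    intro ρ f hf h
    refine ⟨base h.1, fun d => ?_⟩
    have hfd : ∀ q : V × W, fderiv ℝ (fun q : V × W => f q.1) q (e' d)
        = fderiv ℝ f q.1 (e' d).1 := by
      intro q
      have h2 : fderiv ℝ (fun q : V × W => f q.1) q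
          = (fderiv ℝ f q.1).comp (ContinuousLinearMap.fst ℝ V W) :=
        ((sm_diff hf q.1).hasFDerivAt.comp q hasFDerivAt_fst).fderiv
      rw [h2]; rfl
    rcases hcase d with ⟨j, hj, hτj⟩ | h0
    · have h3 := ih (dd_smooth e j hf) (h.2 j)
      have h4 : dd e' d (fun q : V × W => f q.1) = fun q => dd e j f q.1 := by
        funext q; simp only [dd]; rw [hfd, hj]
      rw [h4]
      convert h3 using 1
      funext q; rw [hτj]
    · have h4 : dd e' d (fun q : V × W => f q.1) = fun q => 0 := by
        funext q; simp only [dd]; rw [hfd, h0]; simp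
      rw [h4]; exact Ob.zero

lemma Ob.word (L : List J) : ∀ {ρ : V → ℝ} {f : V → E}, Ob e τ L.length ρ f →
    ∃ C, 0 ≤ C ∧ ∀ q, ‖Dw e L f q‖ ≤ C * (ρ q * (L.map (fun j => τ j q)).prod) := by
  induction L with
  | nil => intro ρ f h; simpa [Dw] using h.base
  | cons j L ih =>
    intro ρ f h
    obtain ⟨C, hC, h'⟩ := ih (h.2 j)
    refine ⟨C, hC, fun q => ?_⟩
    have := h' q
    simpa only [List.map_cons, List.prod_cons, mul_assoc, Dw] using this

lemma Ob.of_word {k : ℕ} : ∀ {ρ : V → ℝ} {f : V → E},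
    (∀ L : List J, ∃ C, 0 ≤ C ∧ ∀ q, ‖Dw e L f q‖ ≤ C * (ρ q * (L.map (fun j => τ j q)).prod)) →
    Ob e τ k ρ f := by
  induction k with
  | zero => intro ρ f h; simpa [Dw, Ob] using h []
  | succ k ih =>
    intro ρ f h
    refine ⟨by simpa [Dw] using h [], fun j => ih fun L => ?_⟩
    obtain ⟨C, hC, h'⟩ := h (j :: L)
    refine ⟨C, hC, fun q => ?_⟩
    have := h' q
    simpa only [List.map_cons, List.prod_cons, mul_assoc, Dw] using this

/-- Composition lemma. -/
lemma Ob.comp [Fintype K] {ι : Type*} (hτ : ∀ j q, 0 ≤ τ j q) {e' : K → W} {τ' : K → W → ℝ}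
    (hτ' : ∀ j q, 0 ≤ τ' j q)
    (Φ : V → W) (φ : K → V → ℝ) (hφ : ∀ j, ContDiff ℝ (⊤ : ℕ∞) (φ j))
    (hΦ : ∀ q, Φ q = ∑ j, φ j q • e' j) (μ : K → V → ℝ)
    (hμ : ∀ j d k, Ob e τ k (fun q => μ j q * τ d q) (dd e d (φ j)))
    (ρ' : ι → W → ℝ) (ρ : ι → V → ℝ) (shift : K → ι → ι)
    (h1 : ∀ p j, ∃ C, 0 ≤ C ∧ ∀ q, ρ' p q * τ' j q ≤ C * ρ' (shift j p) q)
    (h2 : ∀ p, ∃ C, 0 ≤ C ∧ ∀ q, ρ' p (Φ q) ≤ C * ρ p q)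
    (h3 : ∀ p j, ∃ C, 0 ≤ C ∧ ∀ q, ρ (shift j p) q * μ j q ≤ C * ρ p q)
    (k : ℕ) : ∀ (p : ι) {F : W → E}, ContDiff ℝ (⊤ : ℕ∞) F → (∀ k, Ob e' τ' k (ρ' p) F) →
      Ob e τ k (ρ p) (fun q => F (Φ q)) := by
  have hΦs : ContDiff ℝ (⊤ : ℕ∞) Φ := by
    have : Φ = fun q => ∑ j, φ j q • e' j := funext hΦ
    rw [this]
    exact ContDiff.sum fun j _ => (hφ j).smul contDiff_const
  have base : ∀ (p : ι) {F : W → E}, (∀ k, Ob e' τ' k (ρ' p) F) →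
      ∃ C, 0 ≤ C ∧ ∀ q, ‖F (Φ q)‖ ≤ C * ρ p q := by
    intro p F hF
    obtain ⟨C, hC, h⟩ := (hF 0).base
    obtain ⟨C', hC', h'⟩ := h2 p
    refine ⟨C * C', mul_nonneg hC hC', fun q => (h _).trans ?_⟩
    rw [mul_assoc]
    exact mul_le_mul_of_nonneg_left (h' q) hC
  induction k with
  | zero => intro p F _ hF; exact base p hF
  | succ k ih =>
    intro p F hFs hF
    refine ⟨base p hF, fun d => ?_⟩
    have hder : dd e d (fun q => F (Φ q)) =
        fun q => ∑ j, dd e d (φ j) q • dd e' j F (Φ q) := by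
      funext q
      unfold dd
      have a1 : HasFDerivAt Φ (∑ j, (fderiv ℝ (φ j) q).smulRight (e' j)) q := by
        have : Φ = fun q => ∑ j, φ j q • e' j := funext hΦ
        rw [this]
        exact HasFDerivAt.fun_sum fun j _ => (sm_diff (hφ j) q).hasFDerivAt.smul_const (e' j)
      have a2 : fderiv ℝ (fun q => F (Φ q)) q = (fderiv ℝ F (Φ q)).comp _ :=
        ((sm_diff hFs (Φ q)).hasFDerivAt.comp q a1).fderiv
      rw [a2]
      simp
    rw [hder]
    refine Ob.sum _ (fun j => (dd_smooth e d (hφ j)).smul ((dd_smooth e' j hFs).comp hΦs)) ?_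
    intro j
    have b1 : ∀ k, Ob e' τ' k (ρ' (shift j p)) (dd e' j F) := fun k =>
      Ob.mono hτ' (h1 p j) ((hF (k + 1)).2 j)
    have b2 := ih (shift j p) (dd_smooth e' j hFs) b1
    refine Ob.mono hτ ?_ (Ob.smul (dd_smooth e d (hφ j)) ((dd_smooth e' j hFs).comp hΦs)
      (hμ j d k) b2)
    obtain ⟨C, hC, h⟩ := h3 p j
    refine ⟨C, hC, fun q => ?_⟩
    have := mul_le_mul_of_nonneg_right (h q) (hτ d q)
    calc _ = ρ (shift j p) q * μ j q * τ d q := by ring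
      _ ≤ _ := this
      _ = _ := by ring

end Gen

section Words

/-- The word of a multi-index. -/
def Wd {n : ℕ} (ν : Fin n → ℕ) : List (Fin n) → List (Fin n)
  | [] => []
  | i :: l => Wd ν l ++ List.replicate (ν i) i

/-- The standard basis. -/
def eb {n : ℕ} (i : Fin n) : Fin n → ℝ := Pi.single i 1

variable {E : Type*} [NormedAddCommGroup E] [NormedSpace ℝ E]

lemma Dw_replicate {n : ℕ} (i : Fin n) (k : ℕ) (g : (Fin n → ℝ) → E) :
    (pd i)^[k] g = Dw eb (List.replicate k i) g := by
  induction k generalizing g with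
  | zero => rfl
  | succ k ih => rw [Function.iterate_succ_apply, ih]; rfl

lemma pdm_eq {n : ℕ} (ν : Fin n → ℕ) (f : (Fin n → ℝ) → E) :
    pdm ν f = Dw eb (Wd ν (List.finRange n)) f := by
  unfold pdm
  induction (List.finRange n) with
  | nil => rfl
  | cons i l ih => rw [List.foldr_cons, ih, Wd, Dw_append, Dw_replicate]

lemma Wd_length {n : ℕ} (ν : Fin n → ℕ) : (Wd ν (List.finRange n)).length = msize ν := by
  have : ∀ l : List (Fin n), (Wd ν l).length = (l.map ν).sum := by
    intro l
    induction l with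
    | nil => rfl
    | cons i l ih => simp [Wd, ih, add_comm]
  rw [this, msize, Fin.sum_univ_def]

lemma Wd_count {n : ℕ} (ν : Fin n → ℕ) (i : Fin n) :
    (Wd ν (List.finRange n)).count i = ν i := by
  have : ∀ l : List (Fin n), (Wd ν l).count i = l.count i * ν i := by
    intro l
    induction l with
    | nil => simp [Wd]
    | cons a l ih =>
      rw [Wd, List.count_append, ih, List.count_replicate, List.count_cons, add_mul]
      by_cases h : a = i
      · subst h; simp
      · simp [h]
  rw [this, List.count_eq_one_of_mem (List.nodup_finRange n) (List.mem_finRange i), one_mul]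

/-- Basis of the product of two copies. -/
def e2 {n : ℕ} : Fin n ⊕ Fin n → (Fin n → ℝ) × (Fin n → ℝ) :=
  Sum.elim (fun i => (eb i, 0)) (fun i => (0, eb i))

/-- Basis of the product of three copies. -/
def e3 {n : ℕ} : (Fin n ⊕ Fin n) ⊕ Fin n → ((Fin n → ℝ) × (Fin n → ℝ)) × (Fin n → ℝ) :=
  Sum.elim (fun j => (e2 j, 0)) (fun i => (0, eb i))

/-- Canonical word in two groups of variables. -/
def cw2 {n : ℕ} (α β : Fin n → ℕ) : List (Fin n ⊕ Fin n) :=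
  (Wd β (List.finRange n)).map Sum.inr ++ (Wd α (List.finRange n)).map Sum.inl

lemma pdm2_eq {n : ℕ} (α β : Fin n → ℕ) (f : (Fin n → ℝ) → (Fin n → ℝ) → E)
    (hf : ContDiff ℝ (⊤ : ℕ∞) (fun q : (Fin n → ℝ) × (Fin n → ℝ) => f q.1 q.2))
    (q : (Fin n → ℝ) × (Fin n → ℝ)) :
    pdm2 α β f q.1 q.2 = Dw e2 (cw2 α β) (fun q => f q.1 q.2) q := by
  obtain ⟨x, y⟩ := q
  unfold pdm2
  have h1 : ∀ x', pdm β (f x') y =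
      Dw e2 ((Wd β (List.finRange n)).map Sum.inr) (fun q => f q.1 q.2) (x', y) := by
    intro x'
    rw [pdm_eq]
    exact Dw_slice eb e2 Sum.inr (fun y => (x', y)) (ContinuousLinearMap.inr ℝ _ _)
      (fun v => hasFDerivAt_prodMk_right x' v) (fun j => rfl) _ hf y
  simp only [h1]
  rw [pdm_eq, cw2, Dw_append]
  exact Dw_slice eb e2 Sum.inl (fun x => (x, y)) (ContinuousLinearMap.inl ℝ _ _)
      (fun v => hasFDerivAt_prodMk_left v y) (fun j => rfl) _ (Dw_smooth _ _ hf) x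

lemma pdm3_eq {n : ℕ} (α β γ : Fin n → ℕ) (f : (Fin n → ℝ) → (Fin n → ℝ) → (Fin n → ℝ) → E)
    (hf : ContDiff ℝ (⊤ : ℕ∞)
      (fun q : ((Fin n → ℝ) × (Fin n → ℝ)) × (Fin n → ℝ) => f q.1.1 q.1.2 q.2))
    (x y z : Fin n → ℝ) :
    pdm3 α β γ f x y z = Dw e3 ((Wd γ (List.finRange n)).map Sum.inr ++ (cw2 α β).map Sum.inl)
      (fun q => f q.1.1 q.1.2 q.2) ((x, y), z) := by
  have h1 : ∀ x' y', pdm γ (f x' y') z =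
      Dw e3 ((Wd γ (List.finRange n)).map Sum.inr) (fun q => f q.1.1 q.1.2 q.2) ((x', y'), z) := by
    intro x' y'
    rw [pdm_eq]
    exact Dw_slice eb e3 Sum.inr (fun z => ((x', y'), z)) (ContinuousLinearMap.inr ℝ _ _)
      (fun v => hasFDerivAt_prodMk_right (x', y') v) (fun j => rfl) _ hf z
  have h2 : pdm3 α β γ f x y z = pdm2 α β (fun x' y' => Dw e3 ((Wd γ (List.finRange n)).map Sum.inr)
      (fun q => f q.1.1 q.1.2 q.2) ((x', y'), z)) x y := by
    unfold pdm3 pdm2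
    simp only [h1]
  have hs : ContDiff ℝ (⊤ : ℕ∞) (Dw e3 ((Wd γ (List.finRange n)).map Sum.inr)
      (fun q : ((Fin n → ℝ) × (Fin n → ℝ)) × (Fin n → ℝ) => f q.1.1 q.1.2 q.2)) :=
    Dw_smooth _ _ hf
  rw [h2, pdm2_eq α β _ (hs.comp (by fun_prop :
    ContDiff ℝ (⊤ : ℕ∞) (fun q : (Fin n → ℝ) × (Fin n → ℝ) => ((q.1, q.2), z)))) (x, y), Dw_append]
  exact Dw_slice e2 e3 Sum.inl (fun q : (Fin n → ℝ) × (Fin n → ℝ) => (q, z))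
      (ContinuousLinearMap.inl ℝ _ _)
      (fun v => hasFDerivAt_prodMk_left v z) (fun j => rfl) _ hs (x, y)

lemma cw2_perm {n : ℕ} (L : List (Fin n ⊕ Fin n)) : ∃ α β, L.Perm (cw2 α β) := by
  let _ : BEq (Fin n ⊕ Fin n) := instBEqOfDecidableEq
  refine ⟨fun i => L.count (Sum.inl i), fun i => L.count (Sum.inr i), ?_⟩
  rw [List.perm_iff_count]
  rintro (i | i)
  · rw [cw2, List.count_append, List.count_map_of_injective _ _ Sum.inl_injective, Wd_count,
      List.count_eq_zero_of_not_mem (a := Sum.inl i) (l := List.map Sum.inr _) (by simp), zero_add]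
  · rw [cw2, List.count_append, List.count_map_of_injective _ _ Sum.inr_injective, Wd_count,
      List.count_eq_zero_of_not_mem (a := Sum.inr i) (l := List.map Sum.inl _) (by simp), add_zero]

lemma cw2_length {n : ℕ} (α β : Fin n → ℕ) : (cw2 α β).length = msize α + msize β := by
  simp [cw2, Wd_length, add_comm]

lemma cw2_prod {n : ℕ} (α β : Fin n → ℕ) (t : Fin n ⊕ Fin n → ℝ) (a b : ℝ)
    (ha : ∀ i, t (Sum.inl i) = a) (hb : ∀ i, t (Sum.inr i) = b) :
    ((cw2 α β).map t).prod = a ^ msize α * b ^ msize β := by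
  simp only [cw2, List.map_append, List.prod_append, List.map_map, Function.comp_def, ha, hb]
  simp [Wd_length, mul_comm]

lemma Ob_of_pdm2 {n : ℕ} {f : (Fin n → ℝ) → (Fin n → ℝ) → E}
    (hf : ContDiff ℝ (⊤ : ℕ∞) (fun q : (Fin n → ℝ) × (Fin n → ℝ) => f q.1 q.2))
    (τ : Fin n ⊕ Fin n → (Fin n → ℝ) × (Fin n → ℝ) → ℝ)
    (a b ρ : (Fin n → ℝ) × (Fin n → ℝ) → ℝ)
    (ha : ∀ i q, τ (Sum.inl i) q = a q) (hb : ∀ i q, τ (Sum.inr i) q = b q)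
    (h : ∀ α β, ∃ C, 0 ≤ C ∧ ∀ q, ‖pdm2 α β f q.1 q.2‖ ≤
      C * (ρ q * (a q ^ msize α * b q ^ msize β))) (k : ℕ) :
    Ob e2 τ k ρ (fun q => f q.1 q.2) := by
  refine Ob.of_word fun L => ?_
  obtain ⟨α, β, hL⟩ := cw2_perm L
  obtain ⟨C, hC, h⟩ := h α β
  refine ⟨C, hC, fun q => ?_⟩
  rw [Dw_perm e2 hL hf, ← pdm2_eq α β f hf, (hL.map _).prod_eq,
    cw2_prod α β _ (a q) (b q) (fun i => ha i q) (fun i => hb i q)]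
  exact h q

lemma Ob_of_pdm2_dd {n : ℕ} {f : (Fin n → ℝ) → (Fin n → ℝ) → E}
    (hf : ContDiff ℝ (⊤ : ℕ∞) (fun q : (Fin n → ℝ) × (Fin n → ℝ) => f q.1 q.2))
    (τ : Fin n ⊕ Fin n → (Fin n → ℝ) × (Fin n → ℝ) → ℝ)
    (a ρ : (Fin n → ℝ) × (Fin n → ℝ) → ℝ)
    (ha : ∀ i q, τ i q = a q)
    (h : ∀ α β k, msize α + msize β = k + 1 → ∃ C, 0 ≤ C ∧ ∀ q, ‖pdm2 α β f q.1 q.2‖ ≤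
      C * (ρ q * a q ^ k)) (d : Fin n ⊕ Fin n) (k : ℕ) :
    Ob e2 τ k ρ (dd e2 d (fun q => f q.1 q.2)) := by
  refine Ob.of_word fun L => ?_
  obtain ⟨α, β, hL⟩ := cw2_perm (d :: L)
  obtain ⟨C, hC, h⟩ := h α β L.length (by rw [← cw2_length, ← hL.length_eq]; rfl)
  refine ⟨C, hC, fun q => ?_⟩
  have h1 : Dw e2 L (dd e2 d (fun q => f q.1 q.2)) q = pdm2 α β f q.1 q.2 := by
    rw [pdm2_eq α β f hf, ← Dw_perm e2 hL hf]; rfl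
  rw [h1]
  simpa [ha] using h q

end Words

section Jb

lemma one_le_jb {n : ℕ} (v : Fin n → ℝ) : 1 ≤ jb v := by
  unfold jb
  rw [Real.one_le_sqrt]
  have : 0 ≤ ∑ i, (v i) ^ 2 := Finset.sum_nonneg fun i _ => sq_nonneg _
  linarith

lemma jb_pos {n : ℕ} (v : Fin n → ℝ) : 0 < jb v := lt_of_lt_of_le one_pos (one_le_jb v)

lemma jb_sq {n : ℕ} (v : Fin n → ℝ) : jb v ^ 2 = 1 + ∑ i, (v i) ^ 2 := by
  unfold jb
  rw [Real.sq_sqrt]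
  have : 0 ≤ ∑ i, (v i) ^ 2 := Finset.sum_nonneg fun i _ => sq_nonneg _
  linarith

lemma abs_le_jb {n : ℕ} (v : Fin n → ℝ) (i : Fin n) : |v i| ≤ jb v := by
  apply abs_le_of_sq_le_sq _ (jb_pos v).le
  rw [jb_sq]
  have := Finset.single_le_sum (f := fun i => (v i) ^ 2) (fun i _ => sq_nonneg _)
    (Finset.mem_univ i)
  linarith

lemma jb_mulVec_le {n : ℕ} (B : ℝ) (hB : 0 ≤ B) (M : Matrix (Fin n) (Fin n) ℝ)
    (hM : ∀ i j, |M i j| ≤ B) (v : Fin n → ℝ) :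
    jb (Matrix.mulVec M v) ≤ (1 + n * (n * B)) * jb v := by
  have h0 := one_le_jb v
  have hn : (0 : ℝ) ≤ n := Nat.cast_nonneg n
  have hi : ∀ i, (Matrix.mulVec M v i) ^ 2 ≤ (n * B * jb v) ^ 2 := by
    intro i
    apply sq_le_sq'
    all_goals
      have : |Matrix.mulVec M v i| ≤ n * B * jb v := by
        simp only [Matrix.mulVec, dotProduct]
        refine (Finset.abs_sum_le_sum_abs _ _).trans ?_
        calc _ ≤ ∑ _j : Fin n, B * jb v := Finset.sum_le_sum fun j _ => by
              rw [abs_mul]; exact mul_le_mul (hM i j) (abs_le_jb v j) (abs_nonneg _) hB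
          _ = _ := by simp [mul_assoc]
      have := abs_le.mp this
      linarith [this.1, this.2]
  refine (sq_le_sq₀ (jb_pos _).le (by positivity)).mp ?_
  rw [jb_sq]
  have hs : ∑ i, (Matrix.mulVec M v i) ^ 2 ≤ n * (n * B * jb v) ^ 2 := by
    calc _ ≤ ∑ _i : Fin n, (n * B * jb v) ^ 2 := Finset.sum_le_sum fun i _ => hi i
      _ = _ := by simp
  have hn2 : (n : ℝ) ≤ (n : ℝ) ^ 2 := by
    exact_mod_cast Nat.le_self_pow (by norm_num) n
  have h1 : (n : ℝ) * (n * B * jb v) ^ 2 ≤ n ^ 2 * (n * B * jb v) ^ 2 :=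
    mul_le_mul_of_nonneg_right hn2 (sq_nonneg _)
  have h2 : 0 ≤ (n : ℝ) * (n * B) * jb v ^ 2 := by positivity
  nlinarith

lemma rpow_comp_le {a b A B : ℝ} (hb : 0 < b) (hA : 0 < A) (hB : 0 < B)
    (h1 : A * b ≤ a) (h2 : a ≤ B * b) (m : ℝ) : a ^ m ≤ (A ^ m + B ^ m) * b ^ m := by
  have hAm := Real.rpow_nonneg hA.le m
  have hBm := Real.rpow_nonneg hB.le m
  have hbm := Real.rpow_nonneg hb.le m
  have ha : 0 < a := lt_of_lt_of_le (by positivity) h1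
  rcases le_total 0 m with h | h
  · calc a ^ m ≤ (B * b) ^ m := Real.rpow_le_rpow ha.le h2 h
      _ = B ^ m * b ^ m := Real.mul_rpow hB.le hb.le
      _ ≤ _ := by nlinarith
  · calc a ^ m ≤ (A * b) ^ m := Real.rpow_le_rpow_of_nonpos (by positivity) h1 h
      _ = A ^ m * b ^ m := Real.mul_rpow hA.le hb.le
      _ ≤ _ := by nlinarith

end Jb

section Main

lemma rpow_neg_mul_nat {X : ℝ} (hX : 0 < X) (a : ℝ) (k : ℕ) : X ^ (a * (k : ℝ)) = (X ^ a) ^ k := by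
  rw [Real.rpow_mul hX.le, Real.rpow_natCast]

/-- Weights of the symbol. -/
def tauS {n : ℕ} (σ : ℝ) : Fin n ⊕ Fin n → (Fin n → ℝ) × (Fin n → ℝ) → ℝ :=
  Sum.elim (fun _ q => jb q.1 ^ (-σ)) (fun _ q => jb q.2 ^ (-1 : ℝ))

/-- Weights of the base. -/
def tauP {n : ℕ} (σ κ : ℝ) : Fin n ⊕ Fin n → (Fin n → ℝ) × (Fin n → ℝ) → ℝ :=
  fun _ q => jb q.1 ^ (-σ) * jb q.2 ^ κ

/-- Weights of the amplitude. -/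
def tau3 {n : ℕ} (σ κ : ℝ) :
    (Fin n ⊕ Fin n) ⊕ Fin n → ((Fin n → ℝ) × (Fin n → ℝ)) × (Fin n → ℝ) → ℝ :=
  Sum.elim (fun j q => tauP σ κ j q.1) (fun _ q => jb q.2 ^ (-1 : ℝ))

lemma tauS_nonneg {n : ℕ} (σ : ℝ) (j : Fin n ⊕ Fin n) (q) : 0 ≤ tauS σ j q := by
  rcases j with i | i
  · exact Real.rpow_nonneg (jb_pos _).le _
  · exact Real.rpow_nonneg (jb_pos _).le _

lemma tauP_nonneg {n : ℕ} (σ κ : ℝ) (j : Fin n ⊕ Fin n) (q) : 0 ≤ tauP σ κ j q :=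
  mul_nonneg (Real.rpow_nonneg (jb_pos _).le _) (Real.rpow_nonneg (jb_pos _).le _)

lemma tau3_nonneg {n : ℕ} (σ κ : ℝ) (j : (Fin n ⊕ Fin n) ⊕ Fin n) (q) : 0 ≤ tau3 σ κ j q := by
  rcases j with i | i
  · exact tauP_nonneg σ κ i q.1
  · exact Real.rpow_nonneg (jb_pos _).le _

variable {E : Type*} [NormedAddCommGroup E] [NormedSpace ℝ E]

lemma Ssym.ob {n : ℕ} {σ l m : ℝ} {s : (Fin n → ℝ) → (Fin n → ℝ) → E} (hs : Ssym σ l m s)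
    (k : ℕ) : Ob e2 (tauS σ) k (fun q => jb q.1 ^ (σ * l) * jb q.2 ^ m) (fun q => s q.1 q.2) := by
  refine Ob_of_pdm2 hs.1 _ (fun q => jb q.1 ^ (-σ)) (fun q => jb q.2 ^ (-1 : ℝ)) _
    (fun _ _ => rfl) (fun _ _ => rfl) ?_ k
  intro α β
  obtain ⟨C, hC, h⟩ := hs.2 α β
  refine ⟨C, hC.le, fun q => (h q.1 q.2).trans (le_of_eq ?_)⟩
  rw [← rpow_neg_mul_nat (jb_pos _), ← rpow_neg_mul_nat (jb_pos _),
    show σ * (l - (msize α : ℝ)) = σ * l + -σ * (msize α : ℝ) by ring,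
    show m - (msize β : ℝ) = m + -1 * (msize β : ℝ) by ring,
    Real.rpow_add (jb_pos _), Real.rpow_add (jb_pos _)]
  ring

lemma Esp.ob {n : ℕ} {σ κ κ' : ℝ} {P : (Fin n → ℝ) → (Fin n → ℝ) → E} (hP : Esp σ κ 0 P)
    (hκ : κ ≤ κ') (k : ℕ) :
    Ob e2 (tauP σ κ') k (fun _ => 1) (fun q => P q.1 q.2) := by
  refine Ob_of_pdm2 hP.1 _ (fun q => jb q.1 ^ (-σ) * jb q.2 ^ κ')
    (fun q => jb q.1 ^ (-σ) * jb q.2 ^ κ') _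
    (fun _ _ => rfl) (fun _ _ => rfl) ?_ k
  intro α β
  obtain ⟨C, hC, h⟩ := hP.2 α β
  refine ⟨C, hC.le, fun q => (h q.1 q.2).trans ?_⟩
  rw [one_mul, ← pow_add, mul_pow, ← rpow_neg_mul_nat (jb_pos _), ← rpow_neg_mul_nat (jb_pos _),
    mul_assoc, neg_mul, zero_add]
  refine mul_le_mul_of_nonneg_left (mul_le_mul_of_nonneg_left ?_
    (Real.rpow_nonneg (jb_pos _).le _)) hC.le
  exact Real.rpow_le_rpow_of_exponent_le (one_le_jb _)
    (mul_le_mul_of_nonneg_right hκ (Nat.cast_nonneg _))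

lemma Hsp.ob {n : ℕ} {σ κ κ' w : ℝ} {g : (Fin n → ℝ) → (Fin n → ℝ) → E} (hg : Hsp σ κ w g)
    (hκ : κ ≤ κ') (d : Fin n ⊕ Fin n) (k : ℕ) :
    Ob e2 (tauP σ κ') k (fun q => jb q.2 ^ w) (dd e2 d (fun q => g q.1 q.2)) := by
  refine Ob_of_pdm2_dd hg.1 _ (fun q => jb q.1 ^ (-σ) * jb q.2 ^ κ') _ (fun _ _ => rfl) ?_ d k
  intro α β k hk
  obtain ⟨C, hC, h⟩ := hg.2 α β (by
    rintro ⟨rfl, rfl⟩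
    simp [msize] at hk)
  refine ⟨C, hC.le, fun q => (h q.1 q.2).trans ?_⟩
  rw [hk, mul_pow, ← rpow_neg_mul_nat (jb_pos _), ← rpow_neg_mul_nat (jb_pos _),
    show (((k + 1 : ℕ) : ℝ) - 1) = k by push_cast; ring, Real.rpow_add (jb_pos _), neg_mul]
  have h1 : jb q.2 ^ (κ * (k : ℝ)) ≤ jb q.2 ^ (κ' * (k : ℝ)) :=
    Real.rpow_le_rpow_of_exponent_le (one_le_jb _)
      (mul_le_mul_of_nonneg_right hκ (Nat.cast_nonneg _))
  have h2 : 0 ≤ C * jb q.1 ^ (-(σ * (k : ℝ))) * jb q.2 ^ w :=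
    mul_nonneg (mul_nonneg hC.le (Real.rpow_nonneg (jb_pos _).le _))
      (Real.rpow_nonneg (jb_pos _).le _)
  calc _ = C * jb q.1 ^ (-(σ * (k : ℝ))) * jb q.2 ^ w * jb q.2 ^ (κ * (k : ℝ)) := by ring
    _ ≤ C * jb q.1 ^ (-(σ * (k : ℝ))) * jb q.2 ^ w * jb q.2 ^ (κ' * (k : ℝ)) :=
      mul_le_mul_of_nonneg_left h1 h2
    _ = _ := by ring

lemma ob_fst3 {n : ℕ} {σ κ : ℝ} {k : ℕ} {ρ : (Fin n → ℝ) × (Fin n → ℝ) → ℝ}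
    {f : (Fin n → ℝ) × (Fin n → ℝ) → E} (hf : ContDiff ℝ (⊤ : ℕ∞) f)
    (h : Ob e2 (tauP σ κ) k ρ f) : Ob e3 (tau3 σ κ) k (fun q => ρ q.1) (fun q => f q.1) := by
  refine Ob.fst ?_ hf h
  rintro (j | i)
  · exact Or.inl ⟨j, rfl, fun q => rfl⟩
  · exact Or.inr rfl

/-- The coordinate functions in the fibre. -/
lemma ob_coord {n : ℕ} (σ κ : ℝ) (k : ℕ) (i : Fin n) :
    Ob e3 (tau3 σ κ) k (fun q => jb q.2)
      (fun q : ((Fin n → ℝ) × (Fin n → ℝ)) × (Fin n → ℝ) => q.2 i) := by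
  have base : ∃ C, 0 ≤ C ∧ ∀ q : ((Fin n → ℝ) × (Fin n → ℝ)) × (Fin n → ℝ),
      ‖q.2 i‖ ≤ C * jb q.2 := ⟨1, zero_le_one, fun q => by
        rw [one_mul]; exact abs_le_jb _ _⟩
  cases k with
  | zero => exact base
  | succ k =>
    refine ⟨base, fun j => ?_⟩
    have hd : dd e3 j (fun q : ((Fin n → ℝ) × (Fin n → ℝ)) × (Fin n → ℝ) => q.2 i)
        = fun _ => (e3 j).2 i := by
      funext q
      unfold dd
      have : HasFDerivAt (fun q : ((Fin n → ℝ) × (Fin n → ℝ)) × (Fin n → ℝ) => q.2 i)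
        ((ContinuousLinearMap.proj (R := ℝ) (φ := fun _ : Fin n => ℝ) i).comp
          (ContinuousLinearMap.snd ℝ ((Fin n → ℝ) × (Fin n → ℝ)) (Fin n → ℝ))) q :=
        ((ContinuousLinearMap.proj (R := ℝ) (φ := fun _ : Fin n => ℝ) i).comp
          (ContinuousLinearMap.snd ℝ ((Fin n → ℝ) × (Fin n → ℝ)) (Fin n → ℝ))).hasFDerivAt
      rw [this.fderiv]; rfl
    rw [hd]
    rcases j with j | j
    · have : (fun _ : ((Fin n → ℝ) × (Fin n → ℝ)) × (Fin n → ℝ) => (e3 (Sum.inl j)).2 i)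
          = fun _ => 0 := by funext _; rfl
      rw [this]; exact Ob.zero
    · have hw : ∀ q : ((Fin n → ℝ) × (Fin n → ℝ)) × (Fin n → ℝ),
          jb q.2 * tau3 σ κ (Sum.inr j) q = 1 := by
        intro q
        simp only [tau3, Sum.elim_inr, Real.rpow_neg_one]
        exact mul_inv_cancel₀ (jb_pos _).ne'
      simp only [hw]
      have b : ∀ a : ℝ, ∃ C, 0 ≤ C ∧ ∀ q : ((Fin n → ℝ) × (Fin n → ℝ)) × (Fin n → ℝ),
          ‖a‖ ≤ C * 1 := fun a => ⟨‖a‖, norm_nonneg _, fun q => by simp⟩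
      cases k with
      | zero => exact b _
      | succ k =>
        refine ⟨b _, fun j' => ?_⟩
        have : dd e3 j' (fun _ : ((Fin n → ℝ) × (Fin n → ℝ)) × (Fin n → ℝ) =>
            (e3 (Sum.inr j)).2 i) = fun _ => 0 := by
          funext q; simp [dd]
        rw [this]; exact Ob.zero

lemma sandwich_rpow {X Z M C c r σ l : ℝ} (hσ : 0 ≤ σ) (hX : 0 < X) (hZ : 1 ≤ Z)
    (hC : 0 < C) (hc : 0 < c)
    (h : σ ≠ 0 → c * X * Z ^ (-r) ≤ M ∧ M ≤ C * X * Z ^ r) :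
    M ^ (σ * l) ≤ (1 + C ^ (σ * l) + c ^ (σ * l)) * (X ^ (σ * l) * Z ^ (σ * r * |l|)) := by
  have hZ0 : 0 < Z := by linarith
  have hCp := Real.rpow_nonneg hC.le (σ * l)
  have hcp := Real.rpow_nonneg hc.le (σ * l)
  rcases eq_or_ne σ 0 with h0 | h0
  · subst h0; simp
  obtain ⟨h1, h2⟩ := h h0
  have hY : 0 ≤ X ^ (σ * l) * Z ^ (σ * r * |l|) :=
    mul_nonneg (Real.rpow_nonneg hX.le _) (Real.rpow_nonneg hZ0.le _)
  have hM : 0 < c * X * Z ^ (-r) := by positivity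
  rcases le_total 0 l with hl | hl
  · calc M ^ (σ * l) ≤ (C * X * Z ^ r) ^ (σ * l) :=
          Real.rpow_le_rpow (hM.le.trans h1) h2 (by positivity)
      _ = C ^ (σ * l) * (X ^ (σ * l) * Z ^ (σ * r * |l|)) := by
          rw [Real.mul_rpow (by positivity) (by positivity), Real.mul_rpow hC.le hX.le,
            ← Real.rpow_mul hZ0.le, abs_of_nonneg hl, mul_assoc]
          ring_nf
      _ ≤ _ := by nlinarith
  · calc M ^ (σ * l) ≤ (c * X * Z ^ (-r)) ^ (σ * l) :=
          Real.rpow_le_rpow_of_nonpos hM h1 (mul_nonpos_of_nonneg_of_nonpos hσ hl)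
      _ = c ^ (σ * l) * (X ^ (σ * l) * Z ^ (σ * r * |l|)) := by
          rw [Real.mul_rpow (by positivity) (by positivity), Real.mul_rpow hc.le hX.le,
            ← Real.rpow_mul hZ0.le, abs_of_nonpos hl, mul_assoc]
          ring_nf
      _ ≤ _ := by nlinarith

lemma pair_eq_sum {n : ℕ} (u v : Fin n → ℝ) :
    (u, v) = ∑ j, (Sum.elim u v j) • (e2 j : (Fin n → ℝ) × (Fin n → ℝ)) := by
  have hu : ∀ u : Fin n → ℝ, ∑ i, u i • eb i = u := by
    intro u
    funext k
    simp [eb, Finset.sum_apply, Pi.single_apply]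
  rw [Fintype.sum_sum_type]
  refine Prod.ext ?_ ?_
  · simp [e2, Prod.fst_sum, hu]
  · simp [e2, Prod.snd_sum, hu]

theorem core {n : ℕ}
    (σ κ l m w : ℝ) (hσ : σ ∈ Set.Icc (0 : ℝ) 1)
    (s : (Fin n → ℝ) → (Fin n → ℝ) → E)
    (hs : Ssym σ l m s)
    (mt : (Fin n → ℝ) → (Fin n → ℝ) → (Fin n → ℝ))
    (hmt : Hsp σ κ w mt)
    (C c r : ℝ) (hC : 0 < C) (hc : 0 < c) (hr : 0 < r)
    (hsand : σ ≠ 0 → ∀ x ζ,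
      c * jb x * jb ζ ^ (-r) ≤ jb (mt x ζ) ∧ jb (mt x ζ) ≤ C * jb x * jb ζ ^ r)
    (P : (Fin n → ℝ) → (Fin n → ℝ) → Matrix (Fin n) (Fin n) ℝ)
    (hPs : ∀ i j, ContDiff ℝ (⊤ : ℕ∞) (fun q : (Fin n → ℝ) × (Fin n → ℝ) => P q.1 q.2 i j))
    (hP : ∀ i j k, Ob e2 (tauP σ (κ + |σ * r - κ + w|)) k (fun _ => 1)
      (fun q : (Fin n → ℝ) × (Fin n → ℝ) => P q.1 q.2 i j))
    (hPlow : ∀ x ζ ϑ, c * jb ϑ ≤ jb (Matrix.mulVec (P x ζ) ϑ)) :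
    Amp σ (κ + |σ * r - κ + w|) l (σ * r * |l|) m
      (fun x ζ ϑ => s (mt x ζ) (Matrix.mulVec (P x ζ) ϑ)) := by
  set κ' := κ + |σ * r - κ + w| with hκ'
  have hκκ' : κ ≤ κ' := by rw [hκ']; linarith [abs_nonneg (σ * r - κ + w)]
  have hκ2 : σ * r + w ≤ κ' := by rw [hκ']; linarith [le_abs_self (σ * r - κ + w)]
  -- smoothness of the coordinates
  let φ : Fin n ⊕ Fin n → ((Fin n → ℝ) × (Fin n → ℝ)) × (Fin n → ℝ) → ℝ :=
    Sum.elim (fun i q => mt q.1.1 q.1.2 i) (fun i q => Matrix.mulVec (P q.1.1 q.1.2) q.2 i)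
  have hterm : ∀ i j, ContDiff ℝ (⊤ : ℕ∞)
      (fun q : ((Fin n → ℝ) × (Fin n → ℝ)) × (Fin n → ℝ) => P q.1.1 q.1.2 i j • q.2 j) := by
    intro i j
    exact ((hPs i j).comp contDiff_fst).smul (by fun_prop)
  have hmul : ∀ i, (fun q : ((Fin n → ℝ) × (Fin n → ℝ)) × (Fin n → ℝ) =>
      Matrix.mulVec (P q.1.1 q.1.2) q.2 i) = fun q => ∑ j, P q.1.1 q.1.2 i j • q.2 j := by
    intro i; funext q; simp [Matrix.mulVec, dotProduct]
  have hφ : ∀ j, ContDiff ℝ (⊤ : ℕ∞) (φ j) := by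
    rintro (i | i)
    · have h1 := (contDiff_pi.mp hmt.1 i)
      exact h1.comp contDiff_fst
    · change ContDiff ℝ (⊤ : ℕ∞) (fun q : ((Fin n → ℝ) × (Fin n → ℝ)) × (Fin n → ℝ) =>
        Matrix.mulVec (P q.1.1 q.1.2) q.2 i)
      rw [hmul]
      exact ContDiff.sum fun j _ => hterm i j
  let Φ : ((Fin n → ℝ) × (Fin n → ℝ)) × (Fin n → ℝ) → (Fin n → ℝ) × (Fin n → ℝ) :=
    fun q => (mt q.1.1 q.1.2, Matrix.mulVec (P q.1.1 q.1.2) q.2)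
  have hΦ : ∀ q, Φ q = ∑ j, φ j q • e2 j := by
    intro q
    refine (pair_eq_sum _ _).trans (Finset.sum_congr rfl ?_)
    rintro (i | i) _ <;> rfl
  have hΦs : ContDiff ℝ (⊤ : ℕ∞) Φ := by
    have : Φ = fun q => ∑ j, φ j q • e2 j := funext hΦ
    rw [this]
    exact ContDiff.sum fun j _ => (hφ j).smul contDiff_const
  have hsm : ContDiff ℝ (⊤ : ℕ∞)
      (fun q : ((Fin n → ℝ) × (Fin n → ℝ)) × (Fin n → ℝ) =>
        s (mt q.1.1 q.1.2) (Matrix.mulVec (P q.1.1 q.1.2) q.2)) := hs.1.comp hΦs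
  let μ : Fin n ⊕ Fin n → ((Fin n → ℝ) × (Fin n → ℝ)) × (Fin n → ℝ) → ℝ :=
    Sum.elim (fun _ q => jb q.1.2 ^ (w - κ') * jb q.1.1 ^ σ) (fun _ q => jb q.2)
  have hμ : ∀ j d k, Ob e3 (tau3 σ κ') k (fun q => μ j q * tau3 σ κ' d q) (dd e3 d (φ j)) := by
    rintro (i | i) d k
    · let T := (ContinuousLinearMap.proj (R := ℝ) (φ := fun _ : Fin n => ℝ) i)
      have hdd : dd e3 d (φ (Sum.inl i)) = fun q =>
          T (fderiv ℝ (fun q : (Fin n → ℝ) × (Fin n → ℝ) => mt q.1 q.2) q.1 (e3 d).1) := by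
        funext q
        have h2 : HasFDerivAt (φ (Sum.inl i)) ((T.comp
            (fderiv ℝ (fun q : (Fin n → ℝ) × (Fin n → ℝ) => mt q.1 q.2) q.1)).comp
            (ContinuousLinearMap.fst ℝ _ _)) q :=
          (T.hasFDerivAt.comp q.1 (sm_diff hmt.1 q.1).hasFDerivAt).comp q hasFDerivAt_fst
        unfold dd
        rw [h2.fderiv]; rfl
      rw [hdd]
      rcases d with d | d
      · have h3 := ob_fst3 (dd_smooth e2 d hmt.1) (hmt.ob hκκ' d k)
        have h4 := Ob.clm T ((dd_smooth e2 d hmt.1).comp contDiff_fst) h3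
        have hw : (fun q : ((Fin n → ℝ) × (Fin n → ℝ)) × (Fin n → ℝ) =>
            μ (Sum.inl i) q * tau3 σ κ' (Sum.inl d) q) = fun q => jb q.1.2 ^ w := by
          funext q
          simp only [μ, tau3, tauP, Sum.elim_inl]
          rw [Real.rpow_sub (jb_pos _), Real.rpow_neg (jb_pos _).le]
          have a1 := (Real.rpow_pos_of_pos (jb_pos q.1.1) σ).ne'
          have a2 := (Real.rpow_pos_of_pos (jb_pos q.1.2) κ').ne'
          field_simp
        rw [hw]
        exact h4
      · have : (fun q : ((Fin n → ℝ) × (Fin n → ℝ)) × (Fin n → ℝ) =>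
            T (fderiv ℝ (fun q : (Fin n → ℝ) × (Fin n → ℝ) => mt q.1 q.2) q.1
              (e3 (Sum.inr d)).1)) = fun _ => 0 := by
          funext q
          simp [e3]
        rw [this]; exact Ob.zero
    · have h1 : Ob e3 (tau3 σ κ') (k + 1) (fun q => jb q.2) (φ (Sum.inr i)) := by
        change Ob e3 (tau3 σ κ') (k + 1) (fun q => jb q.2)
          (fun q : ((Fin n → ℝ) × (Fin n → ℝ)) × (Fin n → ℝ) =>
            Matrix.mulVec (P q.1.1 q.1.2) q.2 i)
        rw [hmul]
        refine Ob.sum _ (fun j => hterm i j) fun j => ?_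
        have := Ob.smul ((hPs i j).comp contDiff_fst) (by fun_prop)
          (ob_fst3 (hPs i j) (hP i j (k + 1))) (ob_coord σ κ' (k + 1) j)
        simpa only [one_mul, Function.comp_def] using this
      exact h1.2 d
  let ρS : ℝ × ℝ → (Fin n → ℝ) × (Fin n → ℝ) → ℝ :=
    fun p q => jb q.1 ^ (σ * p.1) * jb q.2 ^ p.2
  let ρ3 : ℝ × ℝ → ((Fin n → ℝ) × (Fin n → ℝ)) × (Fin n → ℝ) → ℝ :=
    fun p q => jb q.1.1 ^ (σ * p.1) * jb q.1.2 ^ (σ * r * |p.1|) * jb q.2 ^ p.2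
  let shift : Fin n ⊕ Fin n → ℝ × ℝ → ℝ × ℝ :=
    Sum.elim (fun _ p => (p.1 - 1, p.2)) (fun _ p => (p.1, p.2 - 1))
  have hOb : ∀ k, Ob e3 (tau3 σ κ') k (ρ3 (l, m)) (fun q => s (Φ q).1 (Φ q).2) := by
    intro k
    refine Ob.comp (tau3_nonneg σ κ') (tauS_nonneg σ) Φ φ hφ hΦ μ hμ ρS ρ3 shift ?_ ?_ ?_ k (l, m)
      hs.1 (fun k => hs.ob k)
    · rintro p (i | i)
      · refine ⟨1, zero_le_one, fun q => le_of_eq ?_⟩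
        simp only [ρS, tauS, shift, Sum.elim_inl]
        rw [show σ * (p.1 - 1) = σ * p.1 + -σ by ring, Real.rpow_add (jb_pos _)]
        ring
      · refine ⟨1, zero_le_one, fun q => le_of_eq ?_⟩
        simp only [ρS, tauS, shift, Sum.elim_inr]
        rw [show p.2 - 1 = p.2 + -1 by ring, Real.rpow_add (jb_pos _)]
        ring
    · rintro ⟨l, m⟩
      have hB : ∃ B, 0 ≤ B ∧ ∀ x ζ, ∀ i j, |P x ζ i j| ≤ B := by
        have : ∀ i j, ∃ B, 0 ≤ B ∧ ∀ x ζ, |P x ζ i j| ≤ B := by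
          intro i j
          obtain ⟨B, hB, h⟩ := (hP i j 0).base
          exact ⟨B, hB, fun x ζ => by simpa using h (x, ζ)⟩
        choose B hB h using this
        refine ⟨∑ i, ∑ j, B i j, Finset.sum_nonneg fun i _ => Finset.sum_nonneg fun j _ => hB i j,
          fun x ζ i j => (h i j x ζ).trans ?_⟩
        calc B i j ≤ ∑ j, B i j :=
              Finset.single_le_sum (f := fun j => B i j) (fun j _ => hB i j) (Finset.mem_univ j)
          _ ≤ _ := Finset.single_le_sum (f := fun i => ∑ j, B i j)
              (fun i _ => Finset.sum_nonneg fun j _ => hB i j) (Finset.mem_univ i)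
      obtain ⟨B, hB0, hB⟩ := hB
      have hB1 : (0 : ℝ) < 1 + n * (n * B) := by positivity
      refine ⟨(1 + C ^ (σ * l) + c ^ (σ * l)) * (c ^ m + (1 + n * (n * B)) ^ m), ?_, fun q => ?_⟩
      · positivity
      · have h1 := sandwich_rpow (l := l) hσ.1 (jb_pos q.1.1) (one_le_jb q.1.2) hC hc
          (fun h0 => hsand h0 q.1.1 q.1.2)
        have h2 := rpow_comp_le (jb_pos q.2) hc hB1 (hPlow q.1.1 q.1.2 q.2)
          (jb_mulVec_le B hB0 _ (hB q.1.1 q.1.2) q.2) m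
        calc ρS (l, m) (Φ q) ≤ _ := mul_le_mul h1 h2 (Real.rpow_nonneg (jb_pos _).le _)
              ((Real.rpow_nonneg (jb_pos _).le _).trans h1)
          _ = _ := by simp only [ρ3]; ring
    · rintro p (i | i)
      · refine ⟨1, zero_le_one, fun q => ?_⟩
        simp only [ρ3, μ, shift, Sum.elim_inl]
        have hx : jb q.1.1 ^ (σ * (p.1 - 1)) * jb q.1.1 ^ σ = jb q.1.1 ^ (σ * p.1) := by
          rw [← Real.rpow_add (jb_pos _)]; ring_nf
        have hz : jb q.1.2 ^ (σ * r * |p.1 - 1|) * jb q.1.2 ^ (w - κ') ≤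
            jb q.1.2 ^ (σ * r * |p.1|) := by
          rw [← Real.rpow_add (jb_pos _)]
          apply Real.rpow_le_rpow_of_exponent_le (one_le_jb _)
          have h1 : |p.1 - 1| ≤ |p.1| + 1 := by
            have := abs_sub p.1 1
            simpa using this
          have h2 := mul_le_mul_of_nonneg_left h1 (mul_nonneg hσ.1 hr.le)
          linarith
        have hp : 0 ≤ jb q.1.1 ^ (σ * p.1) * jb q.2 ^ p.2 :=
          mul_nonneg (Real.rpow_nonneg (jb_pos _).le _) (Real.rpow_nonneg (jb_pos _).le _)
        calc _ = (jb q.1.1 ^ (σ * (p.1 - 1)) * jb q.1.1 ^ σ) * jb q.2 ^ p.2 *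
              (jb q.1.2 ^ (σ * r * |p.1 - 1|) * jb q.1.2 ^ (w - κ')) := by ring
          _ ≤ jb q.1.1 ^ (σ * p.1) * jb q.2 ^ p.2 * jb q.1.2 ^ (σ * r * |p.1|) := by
              rw [hx]; exact mul_le_mul_of_nonneg_left hz hp
          _ = _ := by ring
      · refine ⟨1, zero_le_one, fun q => le_of_eq ?_⟩
        simp only [ρ3, μ, shift, Sum.elim_inr]
        rw [Real.rpow_sub_one (jb_pos _).ne']
        have := (jb_pos q.2).ne'
        field_simp
  refine ⟨hsm, fun α β γ => ?_⟩
  obtain ⟨K, hK, h⟩ := (hOb _).word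
    ((Wd γ (List.finRange n)).map Sum.inr ++ (cw2 α β).map Sum.inl)
  refine ⟨K + 1, by linarith, fun x ζ ϑ => ?_⟩
  rw [pdm3_eq α β γ _ hsm]
  refine (h ((x, ζ), ϑ)).trans ?_
  have hprod : (((Wd γ (List.finRange n)).map Sum.inr ++ (cw2 α β).map Sum.inl).map
      (fun j => tau3 σ κ' j ((x, ζ), ϑ))).prod =
      (jb ϑ ^ (-1 : ℝ)) ^ msize γ * (jb x ^ (-σ) * jb ζ ^ κ') ^ (msize α + msize β) := by
    simp only [List.map_append, List.prod_append, List.map_map, Function.comp_def, tau3,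
      Sum.elim_inl, Sum.elim_inr, tauP]
    simp [Wd_length, cw2_length]
  rw [hprod, mul_pow, ← rpow_neg_mul_nat (jb_pos _), ← rpow_neg_mul_nat (jb_pos _),
    ← rpow_neg_mul_nat (jb_pos _)]
  simp only [ρ3]
  rw [show σ * (l - ((msize α + msize β : ℕ) : ℝ)) = σ * l + -σ * ((msize α + msize β : ℕ) : ℝ) by
      ring, show m - (msize γ : ℝ) = m + -1 * (msize γ : ℝ) by ring,
    Real.rpow_add (jb_pos _), Real.rpow_add (jb_pos _), Real.rpow_add (jb_pos _)]
  have hnn : 0 ≤ (jb x ^ (σ * l) * jb x ^ (-σ * ((msize α + msize β : ℕ) : ℝ))) *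
      (jb ζ ^ (σ * r * |l|) * jb ζ ^ (κ' * ((msize α + msize β : ℕ) : ℝ))) *
      (jb ϑ ^ m * jb ϑ ^ (-1 * (msize γ : ℝ))) := by
    have := fun (v : Fin n → ℝ) (a : ℝ) => Real.rpow_nonneg (jb_pos v).le a
    exact mul_nonneg (mul_nonneg (mul_nonneg (this _ _) (this _ _))
      (mul_nonneg (this _ _) (this _ _))) (mul_nonneg (this _ _) (this _ _))
  linarith

end Main
attribute [local instance] Matrix.normedAddCommGroup Matrix.normedSpace

/-- Pulling back a symbol `s ∈ S_σ^{l,m}` through a controlled change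
of base point `m̃ ∈ H_{σ,κ}^w` and a fibrewise matrix family `P ∈ E_{σ,κ}^0(M_n(ℝ))`
with `⟨P_{x,ζ}(ϑ)⟩ ≥ c⟨ϑ⟩` produces an amplitude in
`Π_{σ, κ+|σr-κ+w|}^{l, σr|l|, m}`. -/
theorem statement13 {n N : ℕ} (hN : 0 < N)
    (σ κ l m w : ℝ) (hσ : σ ∈ Set.Icc (0 : ℝ) 1) (hκ : 0 ≤ κ)
    (s : (Fin n → ℝ) → (Fin n → ℝ) → Matrix (Fin N) (Fin N) ℂ)
    (hs : Ssym σ l m s)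
    (mt : (Fin n → ℝ) → (Fin n → ℝ) → (Fin n → ℝ))
    (hmt : Hsp σ κ w mt)
    (C c r : ℝ) (hC : 0 < C) (hc : 0 < c) (hr : 0 < r)
    (hsand : σ ≠ 0 → ∀ x ζ,
      c * jb x * jb ζ ^ (-r) ≤ jb (mt x ζ) ∧ jb (mt x ζ) ≤ C * jb x * jb ζ ^ r)
    (P : (Fin n → ℝ) → (Fin n → ℝ) → Matrix (Fin n) (Fin n) ℝ)
    (hP : Esp σ κ 0 P)
    (hPlow : ∀ x ζ ϑ, c * jb ϑ ≤ jb (Matrix.mulVec (P x ζ) ϑ)) :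
    Amp σ (κ + |σ * r - κ + w|) l (σ * r * |l|) m
      (fun x ζ ϑ => s (mt x ζ) (Matrix.mulVec (P x ζ) ϑ)) := by
  have hmono : κ ≤ κ + |σ * r - κ + w| := by linarith [abs_nonneg (σ * r - κ + w)]
  let T : Fin n → Fin n → Matrix (Fin n) (Fin n) ℝ →L[ℝ] ℝ := fun i j =>
    LinearMap.toContinuousLinearMap (Matrix.entryLinearMap ℝ ℝ i j)
  refine core σ κ l m w hσ s hs mt hmt C c r hC hc hr hsand P ?_ ?_ hPlow
  · intro i j
    exact (T i j).contDiff.comp hP.1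
  · intro i j k
    exact Ob.clm (T i j) hP.1 (hP.ob hmono k)
end
end

section
/- Let s > 0 and n ∈ ℕ*. For every nonzero n-multi-index α there exist a finite nonempty index set J_α, nonzero real numbers (λ_{s,α,p})_{p∈J_α} and n-multi-indices β^{α,p,j} (p ∈ J_α, 1 ≤ j ≤ |α|) such that Σ_{j=1}^{|α|} β^{α,p,j} = α for every p ∈ J_α, and such that for every smooth function f : ℝ^n → (0, ∞) one has ∂^α ( 1/f^s ) = (1/f^{|α|+s}) Σ_{p∈J_α} λ_{s,α,p} Π_{j=1}^{|α|} ∂^{β^{α,p,j}} f. -/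
open MeasureTheory
open scoped BigOperators

noncomputable section

lemma pd_smooth {n : ℕ} (i : Fin n) {f : (Fin n → ℝ) → ℝ} (hf : ContDiff ℝ (⊤ : ℕ∞) f) :
    ContDiff ℝ (⊤ : ℕ∞) (pd i f) := by
  unfold pd
  exact (hf.fderiv_right (m := (⊤ : ℕ∞)) (by simp)).clm_apply contDiff_const

lemma pd_iter_smooth {n : ℕ} (i : Fin n) (m : ℕ) {f : (Fin n → ℝ) → ℝ}
    (hf : ContDiff ℝ (⊤ : ℕ∞) f) : ContDiff ℝ (⊤ : ℕ∞) ((pd i)^[m] f) := by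
  induction m with
  | zero => simpa using hf
  | succ m ih => rw [Function.iterate_succ_apply']; exact pd_smooth i ih

lemma pd_comm {n : ℕ} (i j : Fin n) {f : (Fin n → ℝ) → ℝ} (hf : ContDiff ℝ (⊤ : ℕ∞) f) :
    pd i (pd j f) = pd j (pd i f) := by
  have hd : Differentiable ℝ (fderiv ℝ f) :=
    (hf.fderiv_right (m := (⊤ : ℕ∞)) (by simp)).differentiable (by simp)
  have key : ∀ (i j : Fin n) (x : Fin n → ℝ), pd i (pd j f) x
      = fderiv ℝ (fderiv ℝ f) x (Pi.single i 1) (Pi.single j 1) := by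
    intro i j x
    have h := (hd x).hasFDerivAt.clm_apply
      (hasFDerivAt_const (Pi.single j (1 : ℝ) : Fin n → ℝ) x)
    unfold pd
    rw [h.fderiv]
    simp
  funext x
  rw [key, key]
  have hs : IsSymmSndFDerivAt ℝ f x :=
    hf.contDiffAt.isSymmSndFDerivAt (by
      simp only [minSmoothness_of_isRCLikeNormedField]
      exact WithTop.coe_le_coe.2 le_top)
  exact hs _ _

lemma pd_iter_comm {n : ℕ} (i j : Fin n) (m : ℕ) {f : (Fin n → ℝ) → ℝ}
    (hf : ContDiff ℝ (⊤ : ℕ∞) f) : pd i ((pd j)^[m] f) = (pd j)^[m] (pd i f) := by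
  induction m with
  | zero => rfl
  | succ m ih =>
    rw [Function.iterate_succ_apply', Function.iterate_succ_apply', ← ih,
      pd_comm i j (pd_iter_smooth j m hf)]

lemma foldr_smooth {n : ℕ} (ν : Fin n → ℕ) (l : List (Fin n)) {f : (Fin n → ℝ) → ℝ}
    (hf : ContDiff ℝ (⊤ : ℕ∞) f) :
    ContDiff ℝ (⊤ : ℕ∞) (l.foldr (fun i g => (pd i)^[ν i] g) f) := by
  induction l with
  | nil => simpa using hf
  | cons a l ih => exact pd_iter_smooth a _ ih

lemma pdm_smooth {n : ℕ} (ν : Fin n → ℕ) {f : (Fin n → ℝ) → ℝ}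
    (hf : ContDiff ℝ (⊤ : ℕ∞) f) : ContDiff ℝ (⊤ : ℕ∞) (pdm ν f) :=
  foldr_smooth ν _ hf

lemma foldr_not_mem {n : ℕ} (ν : Fin n → ℕ) (i : Fin n) (l : List (Fin n)) (hi : i ∉ l)
    (f : (Fin n → ℝ) → ℝ) :
    l.foldr (fun j g => (pd j)^[(ν + Pi.single i 1 : Fin n → ℕ) j] g) f
      = l.foldr (fun j g => (pd j)^[ν j] g) f := by
  induction l with
  | nil => rfl
  | cons a l ih =>
    simp only [List.mem_cons, not_or] at hi
    have : (ν + Pi.single i 1 : Fin n → ℕ) a = ν a := by simp [Pi.single_apply, Ne.symm hi.1]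
    rw [List.foldr_cons, List.foldr_cons, ih hi.2, this]

lemma pd_foldr {n : ℕ} (ν : Fin n → ℕ) (i : Fin n) (l : List (Fin n)) (hl : l.Nodup)
    (hi : i ∈ l) {f : (Fin n → ℝ) → ℝ} (hf : ContDiff ℝ (⊤ : ℕ∞) f) :
    pd i (l.foldr (fun j g => (pd j)^[ν j] g) f)
      = l.foldr (fun j g => (pd j)^[(ν + Pi.single i 1 : Fin n → ℕ) j] g) f := by
  induction l with
  | nil => simp at hi
  | cons a l ih =>
    rw [List.nodup_cons] at hl
    rw [List.foldr_cons, List.foldr_cons]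
    by_cases h : i = a
    · subst h
      rw [foldr_not_mem ν i l hl.1]
      have : (ν + Pi.single i 1 : Fin n → ℕ) i = ν i + 1 := by simp
      rw [this, Function.iterate_succ_apply']
    · have hil : i ∈ l := by simpa [h] using hi
      have : (ν + Pi.single i 1 : Fin n → ℕ) a = ν a := by simp [Pi.single_apply, Ne.symm h]
      rw [this, ← ih hl.2 hil, pd_iter_comm i a _ (foldr_smooth ν l hf)]

lemma pd_pdm {n : ℕ} (ν : Fin n → ℕ) (i : Fin n) {f : (Fin n → ℝ) → ℝ}
    (hf : ContDiff ℝ (⊤ : ℕ∞) f) : pd i (pdm ν f) = pdm (ν + Pi.single i 1) f :=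
  pd_foldr ν i _ (List.nodup_finRange n) (List.mem_finRange i) hf

lemma pdm_zero {n : ℕ} (f : (Fin n → ℝ) → ℝ) : pdm (0 : Fin n → ℕ) f = f := by
  unfold pdm
  induction List.finRange n with
  | nil => rfl
  | cons a l ih => rw [List.foldr_cons, ih]; rfl

/-- One differentiation step for a single term. -/
lemma pd_term {n k : ℕ} (i : Fin n) (s : ℝ) (β : Fin k → Fin n → ℕ)
    {f : (Fin n → ℝ) → ℝ} (hf : ContDiff ℝ (⊤ : ℕ∞) f) (hpos : ∀ x, 0 < f x)
    (x : Fin n → ℝ) :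
    pd i (fun y => (f y ^ ((k : ℝ) + s))⁻¹ * ∏ j, pdm (β j) f y) x =
      (f x ^ (((k + 1 : ℕ) : ℝ) + s))⁻¹ *
        (-((k : ℝ) + s) * (pd i f x * ∏ j, pdm (β j) f x)
          + ∑ j, f x * ∏ j', pdm (Function.update β j (β j + Pi.single i 1) j') f x) := by
  have hfx := (hf.differentiable (by simp) x).hasFDerivAt
  have h1 : HasFDerivAt (fun y => f y ^ (-((k : ℝ) + s)))
      ((-((k : ℝ) + s) * f x ^ (-((k : ℝ) + s) - 1)) • fderiv ℝ f x) x :=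
    hfx.rpow_const (Or.inl (hpos x).ne')
  have h2 : HasFDerivAt (fun y => ∏ j, pdm (β j) f y)
      (∑ j, (∏ j' ∈ Finset.univ.erase j, pdm (β j') f x) • fderiv ℝ (pdm (β j) f) x) x :=
    HasFDerivAt.finsetProd (fun j _ =>
      ((pdm_smooth (β j) hf).differentiable (by simp) x).hasFDerivAt)
  have hfun : (fun y => (f y ^ ((k : ℝ) + s))⁻¹ * ∏ j, pdm (β j) f y)
      = fun y => f y ^ (-((k : ℝ) + s)) * ∏ j, pdm (β j) f y := by
    funext y; rw [Real.rpow_neg (hpos y).le]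
  have h3 : ∀ j, ∏ j', pdm (Function.update β j (β j + Pi.single i 1) j') f x
      = (∏ j' ∈ Finset.univ.erase j, pdm (β j') f x)
        * fderiv ℝ (pdm (β j) f) x (Pi.single i 1) := by
    intro j
    rw [← Finset.prod_erase_mul _ _ (Finset.mem_univ j)]
    congr 1
    · refine Finset.prod_congr rfl fun j' hj' => ?_
      rw [Function.update_of_ne (Finset.ne_of_mem_erase hj')]
    · rw [Function.update_self, ← pd_pdm _ _ hf]; rfl
  rw [hfun]
  unfold pd
  rw [(h1.fun_mul h2).fderiv]
  simp only [h3, ← Finset.mul_sum]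
  have e1 : (f x ^ (((k + 1 : ℕ) : ℝ) + s))⁻¹ = f x ^ (-((k : ℝ) + s) - 1) := by
    rw [← Real.rpow_neg (hpos x).le]; congr 1; push_cast; ring
  have e2 : f x ^ (-((k : ℝ) + s)) = f x ^ (-((k : ℝ) + s) - 1) * f x := by
    rw [← Real.rpow_add_one (hpos x).ne']; congr 1; ring
  rw [e1, e2]
  simp only [ContinuousLinearMap.add_apply, ContinuousLinearMap.smul_apply, smul_eq_mul,
    ContinuousLinearMap.sum_apply]
  ring

/-- The general formula with an arbitrary finite index type, including `α = 0`. -/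
lemma rep_exists {n : ℕ} (s : ℝ) (hs : 0 < s) (k : ℕ) :
    ∀ α : Fin n → ℕ, msize α = k →
    ∃ (ι : Type) (_ : Fintype ι) (_ : Nonempty ι) (lam : ι → ℝ)
      (βs : ι → Fin k → (Fin n → ℕ)),
      (∀ p, lam p ≠ 0) ∧ (∀ p, ∑ j, βs p j = α) ∧
      ∀ f : (Fin n → ℝ) → ℝ, ContDiff ℝ (⊤ : ℕ∞) f → (∀ x, 0 < f x) →
        ∀ x, pdm α (fun y => (f y ^ s)⁻¹) x =
          (f x ^ ((k : ℝ) + s))⁻¹ * ∑ p, lam p * ∏ j, pdm (βs p j) f x := by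
  induction k with
  | zero =>
    intro α hα
    have h0 : α = 0 := by
      funext i
      have := (Finset.sum_eq_zero_iff.1 hα) i (Finset.mem_univ i)
      simpa using this
    subst h0
    refine ⟨Unit, inferInstance, inferInstance, fun _ => 1, fun _ _ => 0, by simp, by simp, ?_⟩
    intro f hf hpos x
    rw [pdm_zero]
    simp
  | succ k ih =>
    intro α hα
    obtain ⟨i, hi⟩ : ∃ i, α i ≠ 0 := by
      by_contra! h
      simp [msize, h] at hα
    obtain ⟨α', rfl⟩ : ∃ α' : Fin n → ℕ, α = α' + Pi.single i 1 := by
      refine ⟨α - Pi.single i 1, ?_⟩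
      funext j
      by_cases h : j = i
      · subst h; simp; omega
      · simp [Pi.single_apply, h]
    have hk : msize α' = k := by
      have : msize (α' + Pi.single i 1) = msize α' + 1 := by
        simp [msize, Finset.sum_add_distrib]
      omega
    obtain ⟨ι, hι, hne, lam, βs, hlam, hsum, hform⟩ := ih α' hk
    refine ⟨ι × Option (Fin k), inferInstance, inferInstance,
      fun q => q.2.elim (-((k : ℝ) + s) * lam q.1) (fun _ => lam q.1),
      fun q => q.2.elim (Fin.cons (Pi.single i 1) (βs q.1))
        (fun j => Fin.cons 0 (Function.update (βs q.1) j (βs q.1 j + Pi.single i 1))), ?_, ?_, ?_⟩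
    · rintro ⟨p, _ | j⟩
      · have : (k : ℝ) + s ≠ 0 := by positivity
        exact mul_ne_zero (neg_ne_zero.2 this) (hlam p)
      · exact hlam p
    · rintro ⟨p, _ | j⟩
      · simp only [Option.elim, Fin.sum_univ_succ, Fin.cons_zero, Fin.cons_succ, hsum]
        rw [add_comm]
      · simp only [Option.elim, Fin.sum_univ_succ, Fin.cons_zero, Fin.cons_succ, zero_add]
        rw [Finset.sum_update_of_mem (Finset.mem_univ j), ← hsum p,
          ← Finset.add_sum_erase _ _ (Finset.mem_univ j), Finset.sdiff_singleton_eq_erase]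
        abel
    · intro f hf hpos x
      have hF : ContDiff ℝ (⊤ : ℕ∞) (fun y => (f y ^ s)⁻¹) :=
        (hf.rpow_const_of_ne (fun y => (hpos y).ne')).inv
          (fun y => (Real.rpow_pos_of_pos (hpos y) s).ne')
      rw [← pd_pdm α' i hF]
      have hfun : pdm α' (fun y => (f y ^ s)⁻¹) = fun y => ∑ p, lam p *
          ((f y ^ ((k : ℝ) + s))⁻¹ * ∏ j, pdm (βs p j) f y) := by
        funext y
        rw [hform f hf hpos y, Finset.mul_sum]
        exact Finset.sum_congr rfl fun p _ => by ring
      have hdiff : ∀ p, DifferentiableAt ℝ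
          (fun y => (f y ^ ((k : ℝ) + s))⁻¹ * ∏ j, pdm (βs p j) f y) x := by
        intro p
        have c : ContDiff ℝ (⊤ : ℕ∞)
            (fun y => (f y ^ ((k : ℝ) + s))⁻¹ * ∏ j, pdm (βs p j) f y) :=
          ((hf.rpow_const_of_ne (fun y => (hpos y).ne')).inv
            (fun y => (Real.rpow_pos_of_pos (hpos y) _).ne')).mul
            (contDiff_prod fun j _ => pdm_smooth _ hf)
        exact c.differentiable (by simp) x
      have hpd : pd i (pdm α' (fun y => (f y ^ s)⁻¹)) x = ∑ p, lam p *
          pd i (fun y => (f y ^ ((k : ℝ) + s))⁻¹ * ∏ j, pdm (βs p j) f y) x := by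
        rw [hfun]
        unfold pd
        rw [fderiv_fun_sum (fun p _ => (hdiff p).const_mul (lam p)),
          ContinuousLinearMap.sum_apply]
        refine Finset.sum_congr rfl fun p _ => ?_
        rw [fderiv_const_mul (hdiff p)]
        rfl
      rw [hpd, Fintype.sum_prod_type, Finset.mul_sum]
      refine Finset.sum_congr rfl fun p _ => ?_
      rw [pd_term i s (βs p) hf hpos x, Fintype.sum_option]
      have e0 : pdm (Pi.single i 1) f x = pd i f x := by
        rw [← zero_add (Pi.single i 1 : Fin n → ℕ), ← pd_pdm 0 i hf, pdm_zero]
      simp only [Option.elim, Fin.prod_univ_succ, Fin.cons_zero, Fin.cons_succ, e0, pdm_zero,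
        ← Finset.mul_sum]
      ring

/-- Universal formula for the derivatives of `1/f^s`: for every
nonzero multi-index `α` there are finitely many nonzero coefficients `λ_{s,α,p}` and
multi-indices `β^{α,p,j}` summing to `α` such that, for every smooth positive `f`,
`∂^α(1/f^s) = f^{-(|α|+s)} Σ_p λ_{s,α,p} Π_{j=1}^{|α|} ∂^{β^{α,p,j}} f`. -/
theorem statement15 {n : ℕ} (hn : 0 < n) (s : ℝ) (hs : 0 < s)
    (α : Fin n → ℕ) (hα : α ≠ 0) :
    ∃ (J : ℕ) (_ : 0 < J) (lam : Fin J → ℝ)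
      (βs : Fin J → Fin (msize α) → (Fin n → ℕ)),
      (∀ p, lam p ≠ 0) ∧
      (∀ p, ∑ j, βs p j = α) ∧
      ∀ f : (Fin n → ℝ) → ℝ, ContDiff ℝ (⊤ : ℕ∞) f → (∀ x, 0 < f x) →
        ∀ x, pdm α (fun y => (f y ^ s)⁻¹) x =
          (f x ^ ((msize α : ℝ) + s))⁻¹ * ∑ p, lam p * ∏ j, pdm (βs p j) f x := by
  obtain ⟨ι, hι, hne, lam, βs, hlam, hsum, hform⟩ := rep_exists s hs (msize α) α rfl
  let e := (Fintype.equivFin ι).symm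
  refine ⟨Fintype.card ι, Fintype.card_pos, fun p => lam (e p), fun p => βs (e p),
    fun p => hlam _, fun p => hsum _, ?_⟩
  intro f hf hpos x
  rw [hform f hf hpos x]
  congr 1
  exact (Equiv.sum_comp e (fun p => lam p * ∏ j, pdm (βs p j) f x)).symm
end
end

section
/- Fix x ∈ ℝ. Define e_x(θ) := (1 + sinh²x · sin²θ)^{-1/2}, cos_x θ := e_x(θ) cos θ, sin_x θ := e_x(θ) sin θ, the sets ℝ²_C := ℝ² ∖ ((-∞, 0] × {0}) and ℝ²_P := (0, ∞) × (-π, π), and the diffeomorphism χ_x : ℝ²_C → ℝ²_P, χ_x(v₁, v₂) := ( √(v₁² + cosh²x · v₂²), Arg(v₁ + i v₂) ) (Arg the principal argument in (-π, π)), whose inverse is χ_x^{-1}(r, θ) = (r cos_x θ, r sin_x θ). Let f ∈ C^∞(ℝ², ℝ) be such that for every (α, β) ∈ ℕ² ∖ {(0,0)} there is C_{α,β} > 0 with |∂_r^α ∂_θ^β (f ∘ χ_x^{-1})(r, θ)| ≤ C_{α,β} ⟨r⟩^{1-α} for all (r, θ) ∈ ℝ²_P. Then f ∈ G₁(ℝ²,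 ℝ), i.e. for every multi-index ν ≠ 0 there is C_ν > 0 with |∂^ν f(v)| ≤ C_ν ⟨v⟩^{-(|ν|-1)} for all v ∈ ℝ². -/
open MeasureTheory
open scoped BigOperators

noncomputable section

namespace EP

/-- Directional derivative. -/
def D (w : ℝ × ℝ) (G : ℝ × ℝ → ℝ) : ℝ × ℝ → ℝ := fun p => fderiv ℝ G p w

abbrev D1 := D (1, 0)
abbrev D2 := D (0, 1)

abbrev Sm (G : ℝ × ℝ → ℝ) : Prop := ContDiff ℝ (⊤ : ℕ∞) G

lemma Sm.D {G : ℝ × ℝ → ℝ} (h : Sm G) (w : ℝ × ℝ) : Sm (D w G) := by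
  have : ContDiff ℝ (⊤ : ℕ∞) (fderiv ℝ G) := h.fderiv_right (by simp)
  exact this.clm_apply contDiff_const

lemma Sm.iter {G : ℝ × ℝ → ℝ} (h : Sm G) (w : ℝ × ℝ) (n : ℕ) : Sm ((EP.D w)^[n] G) := by
  induction n with
  | zero => exact h
  | succ n ih => rw [Function.iterate_succ_apply']; exact ih.D w

lemma D_comm {G : ℝ × ℝ → ℝ} (h : Sm G) (u w : ℝ × ℝ) : D u (D w G) = D w (D u G) := by
  funext p
  have hs : IsSymmSndFDerivAt ℝ G p := by
    apply (h.contDiffAt (x := p)).isSymmSndFDerivAt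
    simp only [minSmoothness_of_isRCLikeNormedField]
    exact WithTop.coe_le_coe.2 (le_top (a := (2 : ℕ∞)))
  have hd : DifferentiableAt ℝ (fderiv ℝ G) p := by
    have : ContDiff ℝ (⊤ : ℕ∞) (fderiv ℝ G) := h.fderiv_right (by simp)
    exact (this.differentiable (by simp)) p
  have key : ∀ a b : ℝ × ℝ, D a (D b G) p = fderiv ℝ (fderiv ℝ G) p a b := by
    intro a b
    unfold D
    rw [fderiv_clm_apply hd (differentiableAt_const _)]
    simp
  rw [key, key]
  exact hs u w

lemma D_iter_comm {G : ℝ × ℝ → ℝ} (h : Sm G) (u w : ℝ × ℝ) (n : ℕ) :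
    D u ((D w)^[n] G) = (D w)^[n] (D u G) := by
  induction n with
  | zero => rfl
  | succ n ih =>
    rw [Function.iterate_succ_apply', Function.iterate_succ_apply', D_comm (h.iter w n), ih]

lemma deriv_fst {G : ℝ × ℝ → ℝ} (h : Sm G) (r θ : ℝ) :
    deriv (fun r' => G (r', θ)) r = D1 G (r, θ) := by
  have hG : HasFDerivAt G (fderiv ℝ G (r, θ)) (r, θ) :=
    (h.differentiable (by simp) _).hasFDerivAt
  have h2 : HasDerivAt (fun r' : ℝ => (r', θ)) ((1 : ℝ), (0 : ℝ)) r :=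
    (hasDerivAt_id r).prodMk (hasDerivAt_const r θ)
  exact (hG.comp_hasDerivAt r h2).deriv

lemma deriv_snd {G : ℝ × ℝ → ℝ} (h : Sm G) (r θ : ℝ) :
    deriv (fun t => G (r, t)) θ = D2 G (r, θ) := by
  have hG : HasFDerivAt G (fderiv ℝ G (r, θ)) (r, θ) :=
    (h.differentiable (by simp) _).hasFDerivAt
  have h2 : HasDerivAt (fun t : ℝ => (r, t)) ((0 : ℝ), (1 : ℝ)) θ :=
    (hasDerivAt_const θ r).prodMk (hasDerivAt_id θ)
  exact (hG.comp_hasDerivAt θ h2).deriv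

lemma iter_snd {G : ℝ × ℝ → ℝ} (h : Sm G) (n : ℕ) (r : ℝ) :
    iteratedDeriv n (fun t => G (r, t)) = fun t => (D2^[n] G) (r, t) := by
  induction n with
  | zero => simp
  | succ n ih =>
    rw [iteratedDeriv_succ, ih]
    funext t
    rw [Function.iterate_succ_apply', deriv_snd (h.iter _ n)]

lemma iter_fst {G : ℝ × ℝ → ℝ} (h : Sm G) (n : ℕ) (θ : ℝ) :
    iteratedDeriv n (fun t => G (t, θ)) = fun t => (D1^[n] G) (t, θ) := by
  induction n with
  | zero => simp
  | succ n ih =>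
    rw [iteratedDeriv_succ, ih]
    funext t
    rw [Function.iterate_succ_apply', deriv_fst (h.iter _ n)]

lemma pd2_eq {G : ℝ × ℝ → ℝ} (h : Sm G) (α β : ℕ) (r θ : ℝ) :
    pd2 α β (fun a b => G (a, b)) r θ = (D1^[α] (D2^[β] G)) (r, θ) := by
  unfold pd2
  have : (fun r' => iteratedDeriv β (fun θ' => G (r', θ')) θ) =
      fun r' => (D2^[β] G) (r', θ) := by
    funext r'
    rw [iter_snd h]
  rw [this, iter_fst (h.iter _ β)]

/-- The region where the symbol estimates are made. -/
def Om : Set (ℝ × ℝ) := {p | 1 < p.1 ∧ -Real.pi < p.2 ∧ p.2 < Real.pi}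

lemma Om_open : IsOpen Om := by
  unfold Om
  exact (isOpen_lt continuous_const continuous_fst).inter
    ((isOpen_lt continuous_const continuous_snd).inter
      (isOpen_lt continuous_snd continuous_const))

/-- Symbol estimates of order `m` for up to `k` derivatives. -/
def Sy : ℕ → ℤ → (ℝ × ℝ → ℝ) → Prop
  | 0, m, G => ∃ C : ℝ, ∀ p ∈ Om, |G p| ≤ C * p.1 ^ m
  | k + 1, m, G => (∃ C : ℝ, ∀ p ∈ Om, |G p| ≤ C * p.1 ^ m) ∧
      Sy k (m - 1) (D1 G) ∧ Sy k m (D2 G)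

lemma Sy.zero {k : ℕ} {m : ℤ} {G : ℝ × ℝ → ℝ} (h : Sy k m G) :
    ∃ C : ℝ, ∀ p ∈ Om, |G p| ≤ C * p.1 ^ m := by
  cases k with
  | zero => exact h
  | succ k => exact h.1

lemma Sy.pred {k : ℕ} {m : ℤ} {G : ℝ × ℝ → ℝ} (h : Sy (k + 1) m G) : Sy k m G := by
  induction k generalizing m G with
  | zero => exact h.1
  | succ k ih => exact ⟨h.1, ih h.2.1, ih h.2.2⟩

lemma D_congr {G H : ℝ × ℝ → ℝ} (h : Set.EqOn G H Om) (w : ℝ × ℝ) :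
    Set.EqOn (D w G) (D w H) Om := by
  intro p hp
  unfold D
  have : G =ᶠ[nhds p] H := Filter.eventuallyEq_of_mem (Om_open.mem_nhds hp) h
  rw [this.fderiv_eq]

lemma Sy.congr {k : ℕ} {m : ℤ} {G H : ℝ × ℝ → ℝ} (hG : Sy k m G) (h : Set.EqOn H G Om) :
    Sy k m H := by
  have base : ∀ {m : ℤ} {G H : ℝ × ℝ → ℝ}, (∃ C : ℝ, ∀ p ∈ Om, |G p| ≤ C * p.1 ^ m) →
      Set.EqOn H G Om → (∃ C : ℝ, ∀ p ∈ Om, |H p| ≤ C * p.1 ^ m) := by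
    rintro m G H ⟨C, hC⟩ h
    exact ⟨C, fun p hp => by rw [h hp]; exact hC p hp⟩
  induction k generalizing m G H with
  | zero => exact base hG h
  | succ k ih =>
    exact ⟨base hG.1 h, ih hG.2.1 (D_congr h _), ih hG.2.2 (D_congr h _)⟩

abbrev SmO (G : ℝ × ℝ → ℝ) : Prop := ContDiffOn ℝ (⊤ : ℕ∞) G Om

lemma SmO.diff {G : ℝ × ℝ → ℝ} (h : SmO G) {p : ℝ × ℝ} (hp : p ∈ Om) :
    DifferentiableAt ℝ G p :=
  (h.differentiableOn (by simp)).differentiableAt (Om_open.mem_nhds hp)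

lemma SmO.D {G : ℝ × ℝ → ℝ} (h : SmO G) (w : ℝ × ℝ) : SmO (D w G) := by
  have : ContDiffOn ℝ (⊤ : ℕ∞) (fderiv ℝ G) Om := h.fderiv_of_isOpen Om_open (by simp)
  exact this.clm_apply contDiffOn_const

lemma Sy.add {k : ℕ} {m : ℤ} {G H : ℝ × ℝ → ℝ} (sG : SmO G) (sH : SmO H)
    (hG : Sy k m G) (hH : Sy k m H) : Sy k m (fun p => G p + H p) := by
  have base : ∀ {m : ℤ} {G H : ℝ × ℝ → ℝ}, (∃ C : ℝ, ∀ p ∈ Om, |G p| ≤ C * p.1 ^ m) →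
      (∃ C : ℝ, ∀ p ∈ Om, |H p| ≤ C * p.1 ^ m) →
      (∃ C : ℝ, ∀ p ∈ Om, |G p + H p| ≤ C * p.1 ^ m) := by
    rintro m G H ⟨C, hC⟩ ⟨C', hC'⟩
    refine ⟨C + C', fun p hp => (abs_add_le _ _).trans ?_⟩
    rw [add_mul]
    exact add_le_add (hC p hp) (hC' p hp)
  induction k generalizing m G H with
  | zero => exact base hG hH
  | succ k ih =>
    have key : ∀ w, Set.EqOn (EP.D w (fun p => G p + H p)) (fun p => EP.D w G p + EP.D w H p) Om := by
      intro w p hp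
      unfold EP.D
      rw [fderiv_fun_add (sG.diff hp) (sH.diff hp)]
      rfl
    exact ⟨base hG.1 hH.1, (ih (sG.D _) (sH.D _) hG.2.1 hH.2.1).congr (key _),
      (ih (sG.D _) (sH.D _) hG.2.2 hH.2.2).congr (key _)⟩

lemma Sy.mul {k : ℕ} {m n : ℤ} {G H : ℝ × ℝ → ℝ} (sG : SmO G) (sH : SmO H)
    (hG : Sy k m G) (hH : Sy k n H) : Sy k (m + n) (fun p => G p * H p) := by
  have base : ∀ {m n : ℤ} {G H : ℝ × ℝ → ℝ}, (∃ C : ℝ, ∀ p ∈ Om, |G p| ≤ C * p.1 ^ m) →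
      (∃ C : ℝ, ∀ p ∈ Om, |H p| ≤ C * p.1 ^ n) →
      (∃ C : ℝ, ∀ p ∈ Om, |G p * H p| ≤ C * p.1 ^ (m + n)) := by
    rintro m n G H ⟨C, hC⟩ ⟨C', hC'⟩
    refine ⟨C * C', fun p hp => ?_⟩
    have hp0 : p.1 ≠ 0 := by have := hp.1; positivity
    rw [abs_mul, zpow_add₀ hp0]
    calc |G p| * |H p| ≤ (C * p.1 ^ m) * (C' * p.1 ^ n) :=
          mul_le_mul (hC p hp) (hC' p hp) (abs_nonneg _) ((abs_nonneg _).trans (hC p hp))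
      _ = _ := by ring
  induction k generalizing m n G H with
  | zero => exact base hG hH
  | succ k ih =>
    have key : ∀ w, Set.EqOn (EP.D w (fun p => G p * H p))
        (fun p => G p * EP.D w H p + EP.D w G p * H p) Om := by
      intro w p hp
      unfold EP.D
      rw [fderiv_fun_mul (sG.diff hp) (sH.diff hp)]
      simp
      ring
    refine ⟨base hG.1 hH.1, ?_, ?_⟩
    · refine Sy.congr ?_ (key _)
      refine Sy.add (sG.mul (sH.D _)) ((sG.D _).mul sH) ?_ ?_
      · have := ih sG (sH.D _) hG.pred hH.2.1
        rwa [← add_sub_assoc] at this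
      · have := ih (sG.D _) sH hG.2.1 hH.pred
        rwa [sub_add_eq_add_sub] at this
    · refine Sy.congr ?_ (key _)
      exact Sy.add (sG.mul (sH.D _)) ((sG.D _).mul sH) (ih sG (sH.D _) hG.pred hH.2.2)
        (ih (sG.D _) sH hG.2.2 hH.pred)

lemma Sy.const_zero (k : ℕ) (m : ℤ) : Sy k m (fun _ => 0) := by
  have h0 : ∀ m : ℤ, ∃ C : ℝ, ∀ p ∈ Om, |(fun _ : ℝ × ℝ => (0 : ℝ)) p| ≤ C * p.1 ^ m :=
    fun m => ⟨0, by simp⟩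
  have hD : ∀ w, D w (fun _ => 0) = fun _ => 0 := by
    intro w; funext p; simp [D]
  induction k generalizing m with
  | zero => exact h0 m
  | succ k ih => exact ⟨h0 m, by rw [D1, hD]; exact ih _, by rw [D2, hD]; exact ih _⟩

lemma Sy.ang (k : ℕ) {a : ℝ → ℝ} (ha : ContDiff ℝ (⊤ : ℕ∞) a) : Sy k 0 (fun p => a p.2) := by
  have base : ∀ {a : ℝ → ℝ}, ContDiff ℝ (⊤ : ℕ∞) a →
      ∃ C : ℝ, ∀ p ∈ Om, |(fun p : ℝ × ℝ => a p.2) p| ≤ C * p.1 ^ (0 : ℤ) := by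
    intro a ha
    obtain ⟨C, hC⟩ := (isCompact_Icc (a := -Real.pi) (b := Real.pi)).exists_bound_of_continuousOn
      ha.continuous.continuousOn
    exact ⟨C, fun p hp => by simpa using hC p.2 ⟨hp.2.1.le, hp.2.2.le⟩⟩
  induction k generalizing a with
  | zero => exact base ha
  | succ k ih =>
    have key : ∀ w, D w (fun p => a p.2) = fun p => deriv a p.2 * w.2 := by
      intro w; funext p
      have h1 : HasDerivAt a (deriv a p.2) p.2 := (ha.differentiable (by simp) _).hasDerivAt
      have h2 := h1.comp_hasFDerivAt p (hasFDerivAt_snd (𝕜 := ℝ) (p := p))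
      unfold D
      have h3 : fderiv ℝ (fun p : ℝ × ℝ => a p.2) p = _ := h2.fderiv
      rw [h3]; simp
    have hd : ContDiff ℝ (⊤ : ℕ∞) (deriv a) := by
      have := (contDiff_infty_iff_deriv (𝕜 := ℝ) (f := a)).1 ha
      exact this.2
    refine ⟨base ha, ?_, ?_⟩
    · rw [D1, key]; simpa using Sy.const_zero k _
    · rw [D2, key]; simpa using ih hd

lemma SmO.zpow (c : ℝ) (n : ℤ) : SmO (fun p => c * p.1 ^ n) := by
  intro p hp
  have hp0 : p.1 ≠ 0 := by have := hp.1; positivity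
  refine ContDiffAt.contDiffWithinAt (contDiffAt_const.mul ?_)
  cases n with
  | ofNat n => simpa using contDiffAt_fst.pow n
  | negSucc n =>
    simp only [zpow_negSucc]
    exact (contDiffAt_fst.pow _).inv (pow_ne_zero _ hp0)

lemma Sy.zpow (k : ℕ) (c : ℝ) (n : ℤ) : Sy k n (fun p => c * p.1 ^ n) := by
  have base : ∀ (c : ℝ) (n : ℤ), ∃ C : ℝ, ∀ p ∈ Om,
      |(fun p : ℝ × ℝ => c * p.1 ^ n) p| ≤ C * p.1 ^ n := by
    intro c n
    refine ⟨|c|, fun p hp => ?_⟩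
    have hp0 : 0 < p.1 := by have := hp.1; positivity
    have := zpow_pos hp0 n
    simp only [abs_mul]
    rw [abs_of_pos this]
  induction k generalizing c n with
  | zero => exact base c n
  | succ k ih =>
    have key : ∀ w : ℝ × ℝ, Set.EqOn (D w (fun p => c * p.1 ^ n))
        (fun p => (c * n * w.1) * p.1 ^ (n - 1)) Om := by
      intro w p hp
      have hp0 : p.1 ≠ 0 := by have := hp.1; positivity
      have h1 : HasDerivAt (fun t : ℝ => c * t ^ n) (c * (n * p.1 ^ (n - 1))) p.1 :=
        (hasDerivAt_zpow n p.1 (Or.inl hp0)).const_mul c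
      have h2 := h1.comp_hasFDerivAt p (hasFDerivAt_fst (𝕜 := ℝ) (p := p))
      unfold D
      have h3 : fderiv ℝ (fun p : ℝ × ℝ => c * p.1 ^ n) p = _ := h2.fderiv
      rw [h3]; simp; ring
    refine ⟨base c n, (ih _ _).congr (key _), ?_⟩
    refine Sy.congr ?_ (key _)
    simpa using Sy.const_zero k _

/-- Polar map. -/
def Ph (c s : ℝ → ℝ) (p : ℝ × ℝ) : ℝ × ℝ := (p.1 * c p.2, p.1 * s p.2)

lemma Ph_smooth {c s : ℝ → ℝ} (hc : ContDiff ℝ (⊤ : ℕ∞) c)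
    (hs : ContDiff ℝ (⊤ : ℕ∞) s) : ContDiff ℝ (⊤ : ℕ∞) (Ph c s) := by
  unfold Ph
  exact (contDiff_fst.mul (hc.comp contDiff_snd)).prodMk (contDiff_fst.mul (hs.comp contDiff_snd))

lemma clm_pair (L : ℝ × ℝ →L[ℝ] ℝ) (a b : ℝ) : L (a, b) = a * L (1, 0) + b * L (0, 1) := by
  have : ((a, b) : ℝ × ℝ) = a • (1, 0) + b • (0, 1) := by simp
  rw [this, map_add, map_smul, map_smul]; simp

lemma chain1 {c s : ℝ → ℝ} (hc : ContDiff ℝ (⊤ : ℕ∞) c)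
    (hs : ContDiff ℝ (⊤ : ℕ∞) s) {g : ℝ × ℝ → ℝ} (hg : Sm g) (p : ℝ × ℝ) :
    D1 (g ∘ Ph c s) p = c p.2 * D1 g (Ph c s p) + s p.2 * D2 g (Ph c s p) := by
  have hG : HasFDerivAt g (fderiv ℝ g (Ph c s p)) (Ph c s (p.1, p.2)) :=
    (hg.differentiable (by simp) _).hasFDerivAt
  have h2 : HasDerivAt (fun r' : ℝ => Ph c s (r', p.2)) (c p.2, s p.2) p.1 := by
    unfold Ph
    simpa using ((hasDerivAt_id p.1).mul_const (c p.2)).prodMk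
      ((hasDerivAt_id p.1).mul_const (s p.2))
  have h3 := (hG.comp_hasDerivAt p.1 h2).deriv
  have h4 := deriv_fst (hg.comp (Ph_smooth hc hs)) p.1 p.2
  have h5 := h4.symm.trans h3
  rw [clm_pair] at h5
  exact h5

lemma chain2 {c s : ℝ → ℝ} (hc : ContDiff ℝ (⊤ : ℕ∞) c)
    (hs : ContDiff ℝ (⊤ : ℕ∞) s) {g : ℝ × ℝ → ℝ} (hg : Sm g) (p : ℝ × ℝ) :
    D2 (g ∘ Ph c s) p = p.1 * deriv c p.2 * D1 g (Ph c s p) +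
      p.1 * deriv s p.2 * D2 g (Ph c s p) := by
  have hG : HasFDerivAt g (fderiv ℝ g (Ph c s p)) (Ph c s (p.1, p.2)) :=
    (hg.differentiable (by simp) _).hasFDerivAt
  have hc' : HasDerivAt c (deriv c p.2) p.2 := (hc.differentiable (by simp) _).hasDerivAt
  have hs' : HasDerivAt s (deriv s p.2) p.2 := (hs.differentiable (by simp) _).hasDerivAt
  have h2 : HasDerivAt (fun t : ℝ => Ph c s (p.1, t)) (p.1 * deriv c p.2, p.1 * deriv s p.2) p.2 := by
    unfold Ph
    exact (hc'.const_mul p.1).prodMk (hs'.const_mul p.1)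
  have h3 := (hG.comp_hasDerivAt p.2 h2).deriv
  have h4 := deriv_snd (hg.comp (Ph_smooth hc hs)) p.1 p.2
  have h5 := h4.symm.trans h3
  rw [clm_pair] at h5
  exact h5

lemma comb {a b : ℝ → ℝ} (ha : ContDiff ℝ (⊤ : ℕ∞) a) (hb : ContDiff ℝ (⊤ : ℕ∞) b)
    {G H : ℝ × ℝ → ℝ} (sG : SmO G) (sH : SmO H) {k : ℕ} {m : ℤ}
    (hG : Sy k (m - 1) G) (hH : Sy k m H) :
    Sy k (m - 1) (fun p => a p.2 * G p + b p.2 * (1 * p.1 ^ (-1 : ℤ)) * H p) := by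
  have sa : SmO (fun p => a p.2) := (ha.comp contDiff_snd).contDiffOn
  have sb : SmO (fun p => b p.2) := (hb.comp contDiff_snd).contDiffOn
  have h1 := (Sy.ang k ha).mul sa sG hG
  have h2 := ((Sy.ang k hb).mul sb (SmO.zpow 1 (-1)) (Sy.zpow k 1 (-1)))
  have h3 := h2.mul (sb.mul (SmO.zpow 1 (-1))) sH hH
  rw [zero_add] at h1
  rw [show (0 : ℤ) + -1 + m = m - 1 by ring] at h3
  exact Sy.add (sa.mul sG) ((sb.mul (SmO.zpow 1 (-1))).mul sH) h1 h3

/-- The inductive property. -/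
def Q (c s : ℝ → ℝ) (m : ℤ) (g : ℝ × ℝ → ℝ) : Prop :=
  Sm g ∧ ∀ k, Sy k (m - 1) (D1 (g ∘ Ph c s)) ∧ Sy k m (D2 (g ∘ Ph c s))

lemma step {c s : ℝ → ℝ} (hc : ContDiff ℝ (⊤ : ℕ∞) c)
    (hs : ContDiff ℝ (⊤ : ℕ∞) s) (hJ : ∀ θ, c θ * deriv s θ - s θ * deriv c θ ≠ 0) {m : ℤ} {g : ℝ × ℝ → ℝ}
    (hg : Q c s m g) :
    (∀ k, Sy k (m - 1) (D1 g ∘ Ph c s)) ∧ (∀ k, Sy k (m - 1) (D2 g ∘ Ph c s)) := by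
  obtain ⟨sg, hg⟩ := hg
  have hc' : ContDiff ℝ (⊤ : ℕ∞) (deriv c) := ((contDiff_infty_iff_deriv (𝕜 := ℝ)).1 hc).2
  have hs' : ContDiff ℝ (⊤ : ℕ∞) (deriv s) := ((contDiff_infty_iff_deriv (𝕜 := ℝ)).1 hs).2
  have hJs : ContDiff ℝ (⊤ : ℕ∞) (fun θ => c θ * deriv s θ - s θ * deriv c θ) :=
    (hc.mul hs').sub (hs.mul hc')
  have sG : Sm (g ∘ Ph c s) := sg.comp (Ph_smooth hc hs)
  have s1 : SmO (D1 (g ∘ Ph c s)) := (sG.D _).contDiffOn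
  have s2 : SmO (D2 (g ∘ Ph c s)) := (sG.D _).contDiffOn
  constructor
  · intro k
    refine (comb (hs'.div hJs hJ) (hs.neg.div hJs hJ) s1 s2 (hg k).1 (hg k).2).congr ?_
    intro p hp
    have hp0 : p.1 ≠ 0 := by have := hp.1; positivity
    have := hJ p.2
    simp only [chain1 hc hs sg, chain2 hc hs sg, Function.comp, zpow_neg, zpow_one, Pi.div_apply]
    field_simp
    rw [eq_div_iff (by convert this using 1; ring)]
    ring
  · intro k
    refine (comb (hc'.neg.div hJs hJ) (hc.div hJs hJ) s1 s2 (hg k).1 (hg k).2).congr ?_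
    intro p hp
    have hp0 : p.1 ≠ 0 := by have := hp.1; positivity
    have := hJ p.2
    simp only [chain1 hc hs sg, chain2 hc hs sg, Function.comp, zpow_neg, zpow_one, Pi.div_apply]
    field_simp
    rw [eq_div_iff (by convert this using 1; ring)]
    ring

lemma stepQ {c s : ℝ → ℝ} (hc : ContDiff ℝ (⊤ : ℕ∞) c)
    (hs : ContDiff ℝ (⊤ : ℕ∞) s) (hJ : ∀ θ, c θ * deriv s θ - s θ * deriv c θ ≠ 0) {m : ℤ} {g : ℝ × ℝ → ℝ}
    (hg : Q c s m g) : Q c s (m - 1) (D1 g) ∧ Q c s (m - 1) (D2 g) := by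
  have := step hc hs hJ hg
  exact ⟨⟨hg.1.D _, fun k => (this.1 (k + 1)).2⟩, ⟨hg.1.D _, fun k => (this.2 (k + 1)).2⟩⟩

lemma stepN {c s : ℝ → ℝ} (hc : ContDiff ℝ (⊤ : ℕ∞) c)
    (hs : ContDiff ℝ (⊤ : ℕ∞) s) (hJ : ∀ θ, c θ * deriv s θ - s θ * deriv c θ ≠ 0) {m : ℤ} {g : ℝ × ℝ → ℝ}
    (hg : Q c s m g) (α β : ℕ) : Q c s (m - α - β) (D1^[α] (D2^[β] g)) := by
  induction α with
  | zero =>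
    induction β with
    | zero => simpa using hg
    | succ β ih =>
      have := (stepQ hc hs hJ ih).2
      simp only [Function.iterate_zero, id] at this ⊢
      rw [Function.iterate_succ_apply']
      convert this using 1
      push_cast; ring
  | succ α ih =>
    have := (stepQ hc hs hJ ih).1
    rw [Function.iterate_succ_apply']
    convert this using 1
    push_cast; ring

lemma stepFinal {c s : ℝ → ℝ} (hc : ContDiff ℝ (⊤ : ℕ∞) c)
    (hs : ContDiff ℝ (⊤ : ℕ∞) s) (hJ : ∀ θ, c θ * deriv s θ - s θ * deriv c θ ≠ 0) {m : ℤ} {g : ℝ × ℝ → ℝ}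
    (hg : Q c s m g) (α β : ℕ) (h : ¬(α = 0 ∧ β = 0)) :
    ∃ C : ℝ, ∀ p ∈ Om, |(D1^[α] (D2^[β] g)) (Ph c s p)| ≤ C * p.1 ^ (m - α - β) := by
  rcases α with _ | α
  · rcases β with _ | β
    · simp at h
    · have := (step hc hs hJ (stepN hc hs hJ hg 0 β)).2 0
      simp only [Function.iterate_zero, id] at this ⊢
      rw [Function.iterate_succ_apply']
      obtain ⟨C, hC⟩ := this.zero
      refine ⟨C, fun p hp => (hC p hp).trans_eq ?_⟩
      congr 2
      push_cast; ring
  · have := (step hc hs hJ (stepN hc hs hJ hg α β)).1 0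
    rw [Function.iterate_succ_apply']
    obtain ⟨C, hC⟩ := this.zero
    refine ⟨C, fun p hp => (hC p hp).trans_eq ?_⟩
    congr 2
    push_cast; ring

lemma Sy_of_bounds {F : ℝ × ℝ → ℝ} (sF : Sm F)
    (h : ∀ α β : ℕ, ¬(α = 0 ∧ β = 0) →
      ∃ C : ℝ, ∀ p ∈ Om, |(D1^[α] (D2^[β] F)) p| ≤ C * p.1 ^ (1 - (α : ℤ)))
    (k α β : ℕ) (hab : ¬(α = 0 ∧ β = 0)) : Sy k (1 - α) (D1^[α] (D2^[β] F)) := by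
  induction k generalizing α β with
  | zero => exact h α β hab
  | succ k ih =>
    refine ⟨h α β hab, ?_, ?_⟩
    · have := ih (α + 1) β (by simp)
      rw [Function.iterate_succ_apply'] at this
      convert this using 1
      push_cast; ring
    · have := ih α (β + 1) (by simp)
      rw [Function.iterate_succ_apply', ← D_iter_comm (sF.iter _ β)] at this
      exact this

/-- The angular weight. -/
def ee (x θ : ℝ) : ℝ := (Real.sqrt (1 + Real.sinh x ^ 2 * Real.sin θ ^ 2))⁻¹

lemma ee_pos (x θ : ℝ) : 0 < ee x θ := by
  unfold ee; positivity

lemma ee_smooth (x : ℝ) : ContDiff ℝ (⊤ : ℕ∞) (ee x) := by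
  unfold ee
  have h : ContDiff ℝ (⊤ : ℕ∞) (fun θ => 1 + Real.sinh x ^ 2 * Real.sin θ ^ 2) :=
    contDiff_const.add (contDiff_const.mul (Real.contDiff_sin.pow 2))
  have hne : ∀ θ : ℝ, 0 < 1 + Real.sinh x ^ 2 * Real.sin θ ^ 2 := fun θ => by positivity
  exact (h.sqrt (fun θ => (hne θ).ne')).inv (fun θ => (Real.sqrt_pos.2 (hne θ)).ne')

lemma jac (x θ : ℝ) :
    (ee x θ * Real.cos θ) * deriv (fun t => ee x t * Real.sin t) θ -
      (ee x θ * Real.sin θ) * deriv (fun t => ee x t * Real.cos t) θ ≠ 0 := by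
  have he : HasDerivAt (ee x) (deriv (ee x) θ) θ :=
    ((ee_smooth x).differentiable (by simp) _).hasDerivAt
  have h1 : deriv (fun t => ee x t * Real.sin t) θ = _ := (he.mul (Real.hasDerivAt_sin θ)).deriv
  have h2 : deriv (fun t => ee x t * Real.cos t) θ = _ := (he.mul (Real.hasDerivAt_cos θ)).deriv
  rw [h1, h2]
  have h3 := Real.sin_sq_add_cos_sq θ
  have h4 := ee_pos x θ
  have : (ee x θ * Real.cos θ) * (deriv (ee x) θ * Real.sin θ + ee x θ * Real.cos θ) -
      (ee x θ * Real.sin θ) * (deriv (ee x) θ * Real.cos θ + ee x θ * -Real.sin θ) =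
      ee x θ ^ 2 * (Real.sin θ ^ 2 + Real.cos θ ^ 2) := by ring
  rw [this, h3]
  positivity

/-- Off the horizontal axis, the polar coordinates are onto. -/
lemma onto (x v₁ v₂ : ℝ) (h2 : v₂ ≠ 0) (hr : 1 < Real.sqrt (v₁ ^ 2 + Real.cosh x ^ 2 * v₂ ^ 2)) :
    ∃ p ∈ Om, p.1 = Real.sqrt (v₁ ^ 2 + Real.cosh x ^ 2 * v₂ ^ 2) ∧
      Ph (fun θ => ee x θ * Real.cos θ) (fun θ => ee x θ * Real.sin θ) p = (v₁, v₂) := by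
  set r := Real.sqrt (v₁ ^ 2 + Real.cosh x ^ 2 * v₂ ^ 2) with hrdef
  have hr2 : r ^ 2 = v₁ ^ 2 + Real.cosh x ^ 2 * v₂ ^ 2 := Real.sq_sqrt (by positivity)
  set z : ℂ := ⟨v₁, v₂⟩ with hz
  have hz0 : z ≠ 0 := by
    intro h
    exact h2 (by simpa [hz] using congrArg Complex.im h)
  have hρ : 0 < ‖z‖ := norm_pos_iff.2 hz0
  have hρ2 : ‖z‖ ^ 2 = v₁ ^ 2 + v₂ ^ 2 := by
    rw [← Complex.normSq_eq_norm_sq, Complex.normSq_apply]; simp [hz]; ring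
  have hcos : Real.cos z.arg = v₁ / ‖z‖ := Complex.cos_arg hz0
  have hsin : Real.sin z.arg = v₂ / ‖z‖ := Complex.sin_arg z
  have hr0 : 0 < r := by linarith
  have hee : ee x z.arg = ‖z‖ / r := by
    unfold ee
    have : 1 + Real.sinh x ^ 2 * Real.sin z.arg ^ 2 = (r / ‖z‖) ^ 2 := by
      rw [hsin, div_pow, div_pow, hr2, Real.cosh_sq]
      field_simp
      rw [hρ2]; ring
    rw [this, Real.sqrt_sq (by positivity), inv_div]
  refine ⟨(r, z.arg), ⟨hr, Complex.neg_pi_lt_arg z, ?_⟩, rfl, ?_⟩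
  · refine lt_of_le_of_ne (Complex.arg_le_pi z) ?_
    intro h
    exact h2 (Complex.arg_eq_pi_iff.1 h).2
  · simp only [Ph, hee, hcos, hsin, Prod.mk.injEq]
    constructor <;> field_simp

lemma jb_bound {r : ℝ} (hr : 1 < r) (α : ℕ) :
    Real.sqrt (1 + r ^ 2) ^ ((1 : ℝ) - (α : ℝ)) ≤ 2 * r ^ (1 - (α : ℤ)) := by
  have hr0 : 0 < r := by linarith
  have h1 : r ≤ Real.sqrt (1 + r ^ 2) := Real.le_sqrt_of_sq_le (by linarith)
  have h2 : Real.sqrt (1 + r ^ 2) ≤ 2 * r := Real.sqrt_le_iff.2 ⟨by positivity, by nlinarith⟩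
  have e : Real.sqrt (1 + r ^ 2) ^ ((1 : ℝ) - (α : ℝ)) =
      Real.sqrt (1 + r ^ 2) ^ (1 - (α : ℤ)) := by
    rw [← Real.rpow_intCast]; push_cast; rfl
  rw [e]
  rcases α with _ | α
  · simpa using h2
  · have : (1 - ((α + 1 : ℕ) : ℤ)) = -(α : ℤ) := by push_cast; ring
    rw [this, zpow_neg, zpow_neg, zpow_natCast, zpow_natCast]
    have h3 : (Real.sqrt (1 + r ^ 2) ^ α)⁻¹ ≤ (r ^ α)⁻¹ := by gcongr
    have h4 : 0 < (r ^ α)⁻¹ := by positivity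
    linarith

lemma dense_axis : Dense {v : ℝ × ℝ | v.2 ≠ 0} := by
  have h : Dense ({0}ᶜ : Set ℝ) := dense_compl_singleton 0
  exact h.preimage isOpenMap_snd

theorem final (x : ℝ) (G : ℝ × ℝ → ℝ) (hG : Sm G)
    (hbound : ∀ α β : ℕ, ¬(α = 0 ∧ β = 0) → ∃ C > 0, ∀ r θ : ℝ,
      0 < r → -Real.pi < θ → θ < Real.pi →
      |(D1^[α] (D2^[β] (G ∘ Ph (fun θ => ee x θ * Real.cos θ)
          (fun θ => ee x θ * Real.sin θ)))) (r, θ)|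
        ≤ C * Real.sqrt (1 + r ^ 2) ^ ((1 : ℝ) - (α : ℝ)))
    (α β : ℕ) (hab : ¬(α = 0 ∧ β = 0)) : ∃ C > 0, ∀ v₁ v₂ : ℝ,
      |(D1^[α] (D2^[β] G)) (v₁, v₂)| ≤
        C * Real.sqrt (1 + v₁ ^ 2 + v₂ ^ 2) ^ (-(((α + β : ℕ) : ℝ) - 1)) := by
  have hc : ContDiff ℝ (⊤ : ℕ∞) (fun θ => ee x θ * Real.cos θ) :=
    (ee_smooth x).mul Real.contDiff_cos
  have hs : ContDiff ℝ (⊤ : ℕ∞) (fun θ => ee x θ * Real.sin θ) :=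
    (ee_smooth x).mul Real.contDiff_sin
  have hF := hG.comp (Ph_smooth hc hs)
  have hb := Sy_of_bounds hF (fun α β h => by
    obtain ⟨C, hC0, hC⟩ := hbound α β h
    refine ⟨C * 2, fun p hp => (hC p.1 p.2 (by linarith [hp.1]) hp.2.1 hp.2.2).trans ?_⟩
    rw [mul_assoc]
    exact mul_le_mul_of_nonneg_left (jb_bound hp.1 α) hC0.le)
  have hQ : Q (fun θ => ee x θ * Real.cos θ) (fun θ => ee x θ * Real.sin θ) 1 G := by
    refine ⟨hG, fun k => ⟨?_, ?_⟩⟩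
    · simpa using hb k 1 0 (by simp)
    · simpa using hb k 0 1 (by simp)
  obtain ⟨C1, hC1⟩ := stepFinal hc hs (jac x) hQ α β hab
  have hHs : Sm (D1^[α] (D2^[β] G)) := (hG.iter _ β).iter _ α
  set H := D1^[α] (D2^[β] G) with hH
  obtain ⟨C2, hC2⟩ := (isCompact_closedBall (0 : ℝ × ℝ) 1).exists_bound_of_continuousOn
    hHs.continuous.continuousOn
  obtain ⟨n, hn⟩ : ∃ n, α + β = n + 1 := ⟨α + β - 1, by omega⟩
  refine ⟨2 ^ n * (|C1| + |C2| + 1), by positivity, ?_⟩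
  have hexp : ∀ v₁ v₂ : ℝ, Real.sqrt (1 + v₁ ^ 2 + v₂ ^ 2) ^ (-(((α + β : ℕ) : ℝ) - 1)) =
      (Real.sqrt (1 + v₁ ^ 2 + v₂ ^ 2) ^ n)⁻¹ := by
    intro v₁ v₂
    rw [hn]
    push_cast
    rw [add_sub_cancel_right, Real.rpow_neg (Real.sqrt_nonneg _), Real.rpow_natCast]
  have hJ0 : ∀ v₁ v₂ : ℝ, 0 < Real.sqrt (1 + v₁ ^ 2 + v₂ ^ 2) := fun v₁ v₂ =>
    Real.sqrt_pos.2 (by positivity)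
  simp only [hexp]
  have main : ∀ v ∈ {v : ℝ × ℝ | v.2 ≠ 0}, |H v| ≤ 2 ^ n * (|C1| + |C2| + 1) *
      (Real.sqrt (1 + v.1 ^ 2 + v.2 ^ 2) ^ n)⁻¹ := by
    rintro ⟨v₁, v₂⟩ h2
    simp only [Set.mem_ofPred_eq] at h2
    simp only
    set r := Real.sqrt (v₁ ^ 2 + Real.cosh x ^ 2 * v₂ ^ 2) with hrdef
    have hr2 : r ^ 2 = v₁ ^ 2 + Real.cosh x ^ 2 * v₂ ^ 2 := Real.sq_sqrt (by positivity)
    have hch : v₂ ^ 2 ≤ Real.cosh x ^ 2 * v₂ ^ 2 := by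
      rw [Real.cosh_sq]; nlinarith [mul_nonneg (sq_nonneg (Real.sinh x)) (sq_nonneg v₂)]
    have hr0 : 0 ≤ r := Real.sqrt_nonneg _
    have gen : ∀ (R K : ℝ), 1 ≤ R → r ≤ R → |K| ≤ |C1| + |C2| →
        |H (v₁, v₂)| ≤ K * (R ^ n)⁻¹ → |H (v₁, v₂)| ≤ 2 ^ n * (|C1| + |C2| + 1) *
      (Real.sqrt (1 + v₁ ^ 2 + v₂ ^ 2) ^ n)⁻¹ := by
      intro R K hR hrR hK h
      have hJR : Real.sqrt (1 + v₁ ^ 2 + v₂ ^ 2) ≤ 2 * R :=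
        Real.sqrt_le_iff.2 ⟨by positivity, by nlinarith⟩
      have h5 : ((2 * R) ^ n)⁻¹ ≤ (Real.sqrt (1 + v₁ ^ 2 + v₂ ^ 2) ^ n)⁻¹ := by
        have := hJ0 v₁ v₂
        gcongr
      have hR0 : 0 < R := by linarith
      calc |H (v₁, v₂)| ≤ K * (R ^ n)⁻¹ := h
        _ ≤ (|C1| + |C2| + 1) * (R ^ n)⁻¹ := by
            gcongr
            linarith [le_abs_self K]
        _ = 2 ^ n * (|C1| + |C2| + 1) * ((2 * R) ^ n)⁻¹ := by
            rw [mul_pow]; field_simp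
        _ ≤ _ := by gcongr
    rcases lt_or_ge 1 r with h | h
    · obtain ⟨p, hp, hp1, hp2⟩ := onto x v₁ v₂ h2 h
      have h6 := hC1 p hp
      rw [hp2, hp1] at h6
      refine gen r C1 h.le le_rfl (by linarith [abs_nonneg C2]) (h6.trans_eq ?_)
      rw [show (1 : ℤ) - α - β = -(n : ℤ) by omega, zpow_neg, zpow_natCast]
    · refine gen 1 C2 le_rfl h (by linarith [abs_nonneg C1]) ?_
      have hle : r ^ 2 ≤ 1 := by nlinarith
      have h7 := hC2 (v₁, v₂) (by
        rw [mem_closedBall_zero_iff, Prod.norm_def]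
        simp only [sup_le_iff, Real.norm_eq_abs]
        exact ⟨(sq_le_one_iff_abs_le_one _).1 (by nlinarith [sq_nonneg v₂]),
          (sq_le_one_iff_abs_le_one _).1 (by nlinarith [sq_nonneg v₁])⟩)
      simpa using h7
  have hcl : IsClosed {v : ℝ × ℝ | |H v| ≤ 2 ^ n * (|C1| + |C2| + 1) *
      (Real.sqrt (1 + v.1 ^ 2 + v.2 ^ 2) ^ n)⁻¹} := by
    refine isClosed_le hHs.continuous.abs (continuous_const.mul ?_)
    refine Continuous.inv₀ (by fun_prop) (fun v => ?_)
    exact pow_ne_zero _ (hJ0 v.1 v.2).ne'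
  intro v₁ v₂
  have huniv := hcl.closure_subset_iff.2 main
  rw [dense_axis.closure_eq] at huniv
  exact huniv (Set.mem_univ (v₁, v₂))

end EP

/-- If all nonzero mixed derivatives of `f ∘ χ_x⁻¹`, where
`χ_x⁻¹(r,θ) = (r cos_x θ, r sin_x θ)` are the elliptic polar coordinates associated to
the hyperbolic metric, are `O(⟨r⟩^{1-α})` on `(0,∞) × (-π,π)`, then `f ∈ G₁(ℝ², ℝ)`. -/
theorem statement16 (x : ℝ) (f : ℝ → ℝ → ℝ)
    (hf : ContDiff ℝ (⊤ : ℕ∞) (fun v : ℝ × ℝ => f v.1 v.2))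
    (hbound : ∀ α β : ℕ, ¬(α = 0 ∧ β = 0) → ∃ C > 0, ∀ r θ : ℝ,
      0 < r → -Real.pi < θ → θ < Real.pi →
      |pd2 α β (fun r' θ' =>
          f (r' * ((Real.sqrt (1 + Real.sinh x ^ 2 * Real.sin θ' ^ 2))⁻¹ * Real.cos θ'))
            (r' * ((Real.sqrt (1 + Real.sinh x ^ 2 * Real.sin θ' ^ 2))⁻¹ * Real.sin θ')))
          r θ|
        ≤ C * Real.sqrt (1 + r ^ 2) ^ ((1 : ℝ) - (α : ℝ))) :
    ∀ α β : ℕ, ¬(α = 0 ∧ β = 0) → ∃ C > 0, ∀ v₁ v₂ : ℝ,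
      |pd2 α β f v₁ v₂| ≤
        C * Real.sqrt (1 + v₁ ^ 2 + v₂ ^ 2) ^ (-(((α + β : ℕ) : ℝ) - 1)) := by
  intro α β hab
  have key := EP.final x (fun v : ℝ × ℝ => f v.1 v.2) hf (fun α β h => by
    obtain ⟨C, hC0, hC⟩ := hbound α β h
    refine ⟨C, hC0, fun r θ hr h1 h2 => ?_⟩
    have hc : ContDiff ℝ (⊤ : ℕ∞) (fun θ => EP.ee x θ * Real.cos θ) :=
      (EP.ee_smooth x).mul Real.contDiff_cos
    have hs : ContDiff ℝ (⊤ : ℕ∞) (fun θ => EP.ee x θ * Real.sin θ) :=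
      (EP.ee_smooth x).mul Real.contDiff_sin
    have hF := hf.comp (EP.Ph_smooth hc hs)
    rw [← EP.pd2_eq hF α β r θ]
    exact hC r θ hr h1 h2) α β hab
  obtain ⟨C, hC0, hC⟩ := key
  refine ⟨C, hC0, fun v₁ v₂ => ?_⟩
  have h3 := hC v₁ v₂
  rw [← EP.pd2_eq hf α β v₁ v₂] at h3
  exact h3
end
end

section
/- Let r₀ > 0 and set ℝ²_{P,r₀} := (r₀, ∞) × (-π, π). Let f, g, h, w : ℝ²_{P,r₀} → ℝ be of the form (r, θ) ↦ a(θ) cosh r + b(θ) sinh r with a, b smooth on ℝ with all derivatives bounded, and suppose there are ε > 0 and C > 1 such that f ≥ C, f ≥ ε e^r and h² + g² ≥ ε e^{2r} on ℝ²_{P,r₀}. Then: (i) the functions w/(h²+g²)^{3/2}, w/(f²-1)^{3/2}, and any function of the form (r,θ) ↦ (Σ_{k=-4}^{4} b_k(θ) e^{kr}) / ((h²+g²)(1+h²+g²))^{3/2} with b_k smooth with all derivatives bounded, satisfy |∂_r^α ∂_θ^β (·)(r,θ)| ≤ C_{α,β} e^{-2r} for all (α,β) ∈ ℕ²; (ii)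 the functions arcosh(√(1+h²+g²)) and arcosh(f) satisfy |∂_r^α ∂_θ^β (·)(r,θ)| ≤ C_{α,β} ⟨r⟩^{1-α} for α ≤ 1 and |∂_r^α ∂_θ^β (·)(r,θ)| ≤ C'_{α,β} e^{-2r} for α ≥ 2; (iii) the functions w/√(h²+g²) and w/√(f²-1) satisfy |∂_θ^β (·)| ≤ C_{0,β} and |∂_r^α ∂_θ^β (·)| ≤ C'_{α,β} e^{-2r} for α ≥ 1, all bounds uniform on ℝ²_{P,r₀}. -/
open MeasureTheory
open scoped BigOperators

noncomputable section

/-- Smooth near the compact rectangle `[0,X] × [-π,π]`. -/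
def Good (X : ℝ) (Φ : ℝ × ℝ → ℝ) : Prop :=
  ∀ p : ℝ × ℝ, p.1 ∈ Set.Icc 0 X → p.2 ∈ Set.Icc (-Real.pi) Real.pi →
    ContDiffAt ℝ (⊤ : ℕ∞) Φ p

lemma Good.fd {X : ℝ} {Φ : ℝ × ℝ → ℝ} (h : Good X Φ) (v : ℝ × ℝ) :
    Good X (fun p => fderiv ℝ Φ p v) := by
  intro p h1 h2
  have := h p h1 h2
  have h3 : ContDiffAt ℝ (⊤ : ℕ∞) (fderiv ℝ Φ) p := this.fderiv_right (by simp)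
  exact h3.clm_apply contDiffAt_const

lemma Good.bdd {X : ℝ} {Φ : ℝ × ℝ → ℝ} (h : Good X Φ) :
    ∃ C > 0, ∀ x θ, x ∈ Set.Icc 0 X → θ ∈ Set.Icc (-Real.pi) Real.pi → |Φ (x, θ)| ≤ C := by
  have hK : IsCompact (Set.Icc (0 : ℝ) X ×ˢ Set.Icc (-Real.pi) Real.pi) :=
    isCompact_Icc.prod isCompact_Icc
  have hc : ContinuousOn Φ (Set.Icc (0 : ℝ) X ×ˢ Set.Icc (-Real.pi) Real.pi) := fun p hp =>
    (h p hp.1 hp.2).continuousAt.continuousWithinAt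
  obtain ⟨C, hC⟩ := hK.exists_bound_of_continuousOn hc
  refine ⟨max C 1, by positivity, fun x θ hx hθ => ?_⟩
  exact (hC (x, θ) ⟨hx, hθ⟩).trans (le_max_left _ _)

lemma Good.sq {X Y : ℝ} (hXY : X ^ 2 ≤ Y) {Φ : ℝ × ℝ → ℝ} (h : Good Y Φ) :
    Good X (fun p => Φ (p.1 ^ 2, p.2)) := by
  intro p h1 h2
  have h3 : ContDiffAt ℝ (⊤ : ℕ∞) Φ (p.1 ^ 2, p.2) := h _ ⟨by positivity, by
    have := h1.1
    have := h1.2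
    simp only
    nlinarith⟩ h2
  exact ContDiffAt.comp p (f := fun p : ℝ × ℝ => (p.1 ^ 2, p.2)) h3 (by fun_prop)

lemma Good.hasDerivAt_snd {X : ℝ} {Φ : ℝ × ℝ → ℝ} (h : Good X Φ) {x θ : ℝ}
    (hx : x ∈ Set.Icc 0 X) (hθ : θ ∈ Set.Icc (-Real.pi) Real.pi) :
    HasDerivAt (fun t => Φ (x, t)) (fderiv ℝ Φ (x, θ) (0, 1)) θ := by
  have h1 : HasFDerivAt Φ (fderiv ℝ Φ (x, θ)) (x, θ) :=
    ((h (x, θ) hx hθ).differentiableAt (by simp)).hasFDerivAt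
  exact h1.comp_hasDerivAt θ ((hasDerivAt_const θ x).prodMk (hasDerivAt_id θ))

lemma Good.hasDerivAt_fst {X : ℝ} {Φ : ℝ × ℝ → ℝ} (h : Good X Φ) {θ r y' : ℝ} {y : ℝ → ℝ}
    (hx : y r ∈ Set.Icc 0 X) (hθ : θ ∈ Set.Icc (-Real.pi) Real.pi) (hy : HasDerivAt y y' r) :
    HasDerivAt (fun t => Φ (y t, θ)) (y' * fderiv ℝ Φ (y r, θ) (1, 0)) r := by
  have h1 : HasFDerivAt Φ (fderiv ℝ Φ (y r, θ)) (y r, θ) :=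
    ((h (y r, θ) hx hθ).differentiableAt (by simp)).hasFDerivAt
  have h2 := h1.comp_hasDerivAt r (hy.prodMk (hasDerivAt_const r θ))
  have h3 : ((y', 0) : ℝ × ℝ) = y' • ((1, 0) : ℝ × ℝ) := by simp
  rw [h3, map_smul, smul_eq_mul] at h2
  exact h2

/-- Derivatives in `θ`. -/
lemma theta_form {r₀ X : ℝ} (u c y : ℝ → ℝ) (hy : ∀ r, r₀ < r → y r ∈ Set.Icc 0 X) (β : ℕ) :
    ∀ (F : ℝ → ℝ → ℝ) (Φ : ℝ × ℝ → ℝ) (e : ℝ), Good X Φ →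
    (∀ r θ, r₀ < r → -Real.pi < θ → θ < Real.pi → F r θ = e * u r + c r * Φ (y r, θ)) →
    ∃ (Ψ : ℝ × ℝ → ℝ) (e' : ℝ), (e = 0 → e' = 0) ∧ Good X Ψ ∧
      ∀ r θ, r₀ < r → -Real.pi < θ → θ < Real.pi →
        iteratedDeriv β (fun t => F r t) θ = e' * u r + c r * Ψ (y r, θ) := by
  induction β with
  | zero =>
    intro F Φ e hΦ hF
    exact ⟨Φ, e, id, hΦ, by simpa using hF⟩
  | succ n ih =>
    intro F Φ e hΦ hF
    obtain ⟨Ψ, e', he', hΨ, hh⟩ := ih (fun r => deriv (F r)) (fun p => fderiv ℝ Φ p (0, 1)) 0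
      (hΦ.fd _) (by
        intro r θ hr h1 h2
        have hd := ((hΦ.hasDerivAt_snd (hy r hr) ⟨h1.le, h2.le⟩).const_mul (c r)).const_add
          (e * u r)
        have hev : F r =ᶠ[nhds θ] fun t => e * u r + c r * Φ (y r, t) := by
          filter_upwards [Ioo_mem_nhds h1 h2] with t ht using hF r t hr ht.1 ht.2
        rw [hev.deriv_eq, hd.deriv]
        ring)
    refine ⟨Ψ, e', fun _ => he' rfl, hΨ, fun r θ hr h1 h2 => ?_⟩
    rw [iteratedDeriv_succ']
    exact hh r θ hr h1 h2

lemma expneg_mem {r₀ r : ℝ} (h : r₀ < r) : Real.exp (-r) ∈ Set.Icc 0 (Real.exp (-r₀)) :=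
  ⟨(Real.exp_pos _).le, Real.exp_le_exp.2 (by linarith)⟩

lemma expneg2_mem {r₀ r : ℝ} (h : r₀ < r) :
    Real.exp (-2 * r) ∈ Set.Icc 0 (Real.exp (-2 * r₀)) :=
  ⟨(Real.exp_pos _).le, Real.exp_le_exp.2 (by linarith)⟩

lemma hd_exp2 (r : ℝ) : HasDerivAt (fun t : ℝ => Real.exp (-2 * t)) (-2 * Real.exp (-2 * r)) r := by
  have := ((hasDerivAt_id r).const_mul (-2)).exp
  simpa [mul_comm] using this

lemma hd_exp1 (r : ℝ) : HasDerivAt (fun t : ℝ => Real.exp (-t)) (- Real.exp (-r)) r := by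
  have := (hasDerivAt_id r).neg.exp
  simpa [mul_comm] using this

lemma E_step {r₀ : ℝ} {Φ : ℝ × ℝ → ℝ} (hΦ : Good (Real.exp (-r₀)) Φ) :
    ∃ Ψ, Good (Real.exp (-r₀)) Ψ ∧ ∀ (G : ℝ → ℝ) (c θ : ℝ), -Real.pi < θ → θ < Real.pi →
      (∀ r, r₀ < r → G r = c + Real.exp (-2 * r) * Φ (Real.exp (-r), θ)) →
      ∀ r, r₀ < r → deriv G r = Real.exp (-2 * r) * Ψ (Real.exp (-r), θ) := by
  refine ⟨fun p => -2 * Φ p - p.1 * fderiv ℝ Φ p (1, 0), ?_, ?_⟩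
  · intro p h1 h2
    exact (contDiffAt_const.mul (hΦ p h1 h2)).sub (contDiffAt_fst.mul (hΦ.fd (1, 0) p h1 h2))
  · intro G c θ h1 h2 hG r hr
    have hd := ((hd_exp2 r).mul
      (hΦ.hasDerivAt_fst (expneg_mem hr) ⟨h1.le, h2.le⟩ (hd_exp1 r))).const_add c
    have hev : G =ᶠ[nhds r] fun r => c + Real.exp (-2 * r) * Φ (Real.exp (-r), θ) := by
      filter_upwards [Ioi_mem_nhds hr] with t ht using hG t ht
    rw [hev.deriv_eq]
    refine hd.deriv.trans ?_
    simp only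
    ring

lemma E_form {r₀ : ℝ} (α : ℕ) : ∀ {Φ : ℝ × ℝ → ℝ}, Good (Real.exp (-r₀)) Φ →
    ∃ Ψ, Good (Real.exp (-r₀)) Ψ ∧ ∀ (G : ℝ → ℝ) (θ : ℝ), -Real.pi < θ → θ < Real.pi →
      (∀ r, r₀ < r → G r = Real.exp (-2 * r) * Φ (Real.exp (-r), θ)) →
      ∀ r, r₀ < r → iteratedDeriv α G r = Real.exp (-2 * r) * Ψ (Real.exp (-r), θ) := by
  induction α with
  | zero => intro Φ hΦ; exact ⟨Φ, hΦ, by intro G θ _ _ h; simpa using h⟩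
  | succ n ih =>
    intro Φ hΦ
    obtain ⟨Ψ, hΨ, hs⟩ := E_step hΦ
    obtain ⟨Θ, hΘ, ht⟩ := ih hΨ
    refine ⟨Θ, hΘ, fun G θ h1 h2 hG r hr => ?_⟩
    rw [iteratedDeriv_succ']
    exact ht (deriv G) θ h1 h2 (hs G 0 θ h1 h2 (by simpa using hG)) r hr

lemma exp_bd {r₀ : ℝ} {Ψ : ℝ × ℝ → ℝ} (hΨ : Good (Real.exp (-r₀)) Ψ) {G : ℝ → ℝ → ℝ}
    (hG : ∀ r θ, r₀ < r → -Real.pi < θ → θ < Real.pi →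
      G r θ = Real.exp (-2 * r) * Ψ (Real.exp (-r), θ)) :
    ∃ C' > 0, ∀ r θ, r₀ < r → -Real.pi < θ → θ < Real.pi →
      |G r θ| ≤ C' * Real.exp (-2 * r) := by
  obtain ⟨C, hC, hb⟩ := hΨ.bdd
  refine ⟨C, hC, fun r θ hr h1 h2 => ?_⟩
  rw [hG r θ hr h1 h2, abs_mul, abs_of_pos (Real.exp_pos _), mul_comm]
  exact mul_le_mul_of_nonneg_right (hb _ _ (expneg_mem hr) ⟨h1.le, h2.le⟩) (Real.exp_pos _).le

lemma E_bound {r₀ : ℝ} {Φ : ℝ × ℝ → ℝ} (hΦ : Good (Real.exp (-r₀)) Φ) {F : ℝ → ℝ → ℝ}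
    (hF : ∀ r θ, r₀ < r → -Real.pi < θ → θ < Real.pi →
      F r θ = Real.exp (-2 * r) * Φ (Real.exp (-r), θ)) (α β : ℕ) :
    ∃ C' > 0, ∀ r θ, r₀ < r → -Real.pi < θ → θ < Real.pi →
      |pd2 α β F r θ| ≤ C' * Real.exp (-2 * r) := by
  obtain ⟨Ψ, e', he', hΨ, hh⟩ := theta_form (r₀ := r₀) (fun _ => 0) (fun r => Real.exp (-2 * r))
    (fun r => Real.exp (-r)) (fun r hr => expneg_mem hr) β F Φ 0 hΦ (by simpa using hF)
  obtain ⟨Θ, hΘ, ht⟩ := E_form α hΨ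
  refine exp_bd hΘ (fun r θ hr h1 h2 => ?_)
  exact ht (fun r' => iteratedDeriv β (fun θ' => F r' θ') θ) θ h1 h2
    (fun r hr => by simpa using hh r θ hr h1 h2) r hr

/-- Structure of all derivatives of `e r + Φ(e^{-2r}, θ)`. -/
lemma S_form {r₀ : ℝ} {Φ : ℝ × ℝ → ℝ} (hΦ : Good (Real.exp (-2 * r₀)) Φ) {F : ℝ → ℝ → ℝ} {e : ℝ}
    (hF : ∀ r θ, r₀ < r → -Real.pi < θ → θ < Real.pi →
      F r θ = e * r + Φ (Real.exp (-2 * r), θ)) (β : ℕ) :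
    ∃ (e' : ℝ) (Ψ Θ : ℝ × ℝ → ℝ), (e = 0 → e' = 0) ∧ Good (Real.exp (-2 * r₀)) Ψ ∧
      Good (Real.exp (-r₀)) Θ ∧
      (∀ r θ, r₀ < r → -Real.pi < θ → θ < Real.pi →
        pd2 0 β F r θ = e' * r + Ψ (Real.exp (-2 * r), θ)) ∧
      (∀ r θ, r₀ < r → -Real.pi < θ → θ < Real.pi →
        pd2 1 β F r θ = e' + Real.exp (-2 * r) * Θ (Real.exp (-r), θ)) ∧
      (∀ α r θ, pd2 (α + 1) β F r θ = iteratedDeriv α (fun r' => pd2 1 β F r' θ) r) := by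
  obtain ⟨Ψ, e', he', hΨ, hh⟩ := theta_form (r₀ := r₀) (fun r => r) (fun r => 1)
    (fun r => Real.exp (-2 * r)) (fun r hr => expneg2_mem hr) β F Φ e hΦ (by simpa using hF)
  have hX : Real.exp (-r₀) ^ 2 ≤ Real.exp (-2 * r₀) := by
    rw [← Real.exp_nat_mul]; apply le_of_eq; congr 1; push_cast; ring
  refine ⟨e', Ψ, fun p => -2 * fderiv ℝ Ψ (p.1 ^ 2, p.2) (1, 0), he', hΨ, ?_, ?_, ?_, ?_⟩
  · intro p h1 h2
    exact contDiffAt_const.mul ((hΨ.fd (1, 0)).sq hX p h1 h2)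
  · intro r θ hr h1 h2
    simpa [pd2] using hh r θ hr h1 h2
  · intro r θ hr h1 h2
    have hd := ((hasDerivAt_id r).const_mul e').add
      (hΨ.hasDerivAt_fst (expneg2_mem hr) ⟨h1.le, h2.le⟩ (hd_exp2 r))
    have hev : (fun r' => iteratedDeriv β (fun θ' => F r' θ') θ) =ᶠ[nhds r]
        fun r => e' * r + Ψ (Real.exp (-2 * r), θ) := by
      filter_upwards [Ioi_mem_nhds hr] with t ht
      simpa using hh t θ ht h1 h2
    unfold pd2
    rw [iteratedDeriv_one, hev.deriv_eq]
    refine hd.deriv.trans ?_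
    have : Real.exp (-r) ^ 2 = Real.exp (-2 * r) := by
      rw [← Real.exp_nat_mul]; congr 1; push_cast; ring
    simp only [this]
    ring
  · intro α r θ
    simp only [pd2, iteratedDeriv_succ', iteratedDeriv_zero]

lemma S_bound0 {r₀ : ℝ} {Φ : ℝ × ℝ → ℝ} (hΦ : Good (Real.exp (-2 * r₀)) Φ) {F : ℝ → ℝ → ℝ}
    (hF : ∀ r θ, r₀ < r → -Real.pi < θ → θ < Real.pi →
      F r θ = Φ (Real.exp (-2 * r), θ)) (β : ℕ) :
    ∃ C' > 0, ∀ r θ, r₀ < r → -Real.pi < θ → θ < Real.pi → |pd2 0 β F r θ| ≤ C' := by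
  obtain ⟨e', Ψ, Θ, he, hΨ, hΘ, h0, h1, h2⟩ := S_form (e := 0) hΦ (by simpa using hF) β
  obtain ⟨C, hC, hb⟩ := hΨ.bdd
  refine ⟨C, hC, fun r θ hr ha hb' => ?_⟩
  rw [h0 r θ hr ha hb', he rfl, zero_mul, zero_add]
  exact hb _ _ (expneg2_mem hr) ⟨ha.le, hb'.le⟩

lemma S_bound1 {r₀ : ℝ} {Φ : ℝ × ℝ → ℝ} (hΦ : Good (Real.exp (-2 * r₀)) Φ) {F : ℝ → ℝ → ℝ}
    (hF : ∀ r θ, r₀ < r → -Real.pi < θ → θ < Real.pi →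
      F r θ = Φ (Real.exp (-2 * r), θ)) (α β : ℕ) (hα : 1 ≤ α) :
    ∃ C' > 0, ∀ r θ, r₀ < r → -Real.pi < θ → θ < Real.pi →
      |pd2 α β F r θ| ≤ C' * Real.exp (-2 * r) := by
  obtain ⟨e', Ψ, Θ, he, hΨ, hΘ, h0, h1, h2⟩ := S_form (e := 0) hΦ (by simpa using hF) β
  obtain ⟨n, rfl⟩ : ∃ n, α = n + 1 := ⟨α - 1, by omega⟩
  obtain ⟨Ξ, hΞ, ht⟩ := E_form n hΘ
  refine exp_bd hΞ (fun r θ hr ha hb => ?_)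
  rw [h2]
  exact ht _ θ ha hb (fun r hr => by rw [h1 r θ hr ha hb, he rfl, zero_add]) r hr

lemma S_bound2 {r₀ : ℝ} {Φ : ℝ × ℝ → ℝ} (hΦ : Good (Real.exp (-2 * r₀)) Φ) {F : ℝ → ℝ → ℝ}
    (hF : ∀ r θ, r₀ < r → -Real.pi < θ → θ < Real.pi →
      F r θ = r + Φ (Real.exp (-2 * r), θ)) (α β : ℕ) (hα : 2 ≤ α) :
    ∃ C' > 0, ∀ r θ, r₀ < r → -Real.pi < θ → θ < Real.pi →
      |pd2 α β F r θ| ≤ C' * Real.exp (-2 * r) := by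
  obtain ⟨e', Ψ, Θ, he, hΨ, hΘ, h0, h1, h2⟩ := S_form (e := 1) hΦ (by simpa using hF) β
  obtain ⟨n, rfl⟩ : ∃ n, α = n + 1 + 1 := ⟨α - 2, by omega⟩
  obtain ⟨Λ, hΛ, hs⟩ := E_step hΘ
  obtain ⟨Ξ, hΞ, ht⟩ := E_form n hΛ
  refine exp_bd hΞ (fun r θ hr ha hb => ?_)
  rw [h2, iteratedDeriv_succ']
  exact ht _ θ ha hb (hs _ e' θ ha hb (fun r hr => h1 r θ hr ha hb)) r hr

lemma S_boundJ {r₀ : ℝ} (hr₀ : 0 < r₀) {Φ : ℝ × ℝ → ℝ} (hΦ : Good (Real.exp (-2 * r₀)) Φ)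
    {F : ℝ → ℝ → ℝ}
    (hF : ∀ r θ, r₀ < r → -Real.pi < θ → θ < Real.pi →
      F r θ = r + Φ (Real.exp (-2 * r), θ)) (α β : ℕ) (hα : α ≤ 1) :
    ∃ C' > 0, ∀ r θ, r₀ < r → -Real.pi < θ → θ < Real.pi →
      |pd2 α β F r θ| ≤ C' * Real.sqrt (1 + r ^ 2) ^ ((1 : ℝ) - (α : ℝ)) := by
  obtain ⟨e', Ψ, Θ, he, hΨ, hΘ, h0, h1, h2⟩ := S_form (e := 1) hΦ (by simpa using hF) β
  obtain rfl | rfl : α = 0 ∨ α = 1 := by omega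
  · obtain ⟨C, hC, hb⟩ := hΨ.bdd
    refine ⟨|e'| + C, by positivity, fun r θ hr ha hb' => ?_⟩
    rw [h0 r θ hr ha hb']
    have h3 := hb _ _ (expneg2_mem hr) ⟨ha.le, hb'.le⟩
    have h4 : |r| ≤ Real.sqrt (1 + r ^ 2) := Real.abs_le_sqrt (by linarith)
    have h5 : 1 ≤ Real.sqrt (1 + r ^ 2) := Real.one_le_sqrt.2 (by nlinarith)
    simp only [Nat.cast_zero, sub_zero, Real.rpow_one]
    calc _ ≤ |e' * r| + |Ψ (Real.exp (-2 * r), θ)| := abs_add_le _ _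
      _ ≤ |e'| * Real.sqrt (1 + r ^ 2) + C * Real.sqrt (1 + r ^ 2) := by
        rw [abs_mul]
        gcongr
        nlinarith
      _ = _ := by ring
  · obtain ⟨C, hC, hb⟩ := hΘ.bdd
    refine ⟨|e'| + C, by positivity, fun r θ hr ha hb' => ?_⟩
    rw [h1 r θ hr ha hb']
    have h3 := hb _ _ (expneg_mem hr) ⟨ha.le, hb'.le⟩
    have h4 : Real.exp (-2 * r) ≤ 1 := Real.exp_le_one_iff.2 (by linarith)
    simp only [Nat.cast_one, sub_self, Real.rpow_zero, mul_one]
    calc _ ≤ |e'| + |Real.exp (-2 * r) * Θ (Real.exp (-r), θ)| := abs_add_le _ _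
      _ ≤ _ := by
        rw [abs_mul, abs_of_pos (Real.exp_pos _)]
        nlinarith [abs_nonneg (Θ (Real.exp (-r), θ))]

/-- Normal form of `a cosh + b sinh`. -/
lemma nf {f : ℝ → ℝ → ℝ} (hf : ∃ a b : ℝ → ℝ, BddSmooth a ∧ BddSmooth b ∧
      ∀ r θ, f r θ = a θ * Real.cosh r + b θ * Real.sinh r) :
    ∃ F : ℝ × ℝ → ℝ, ContDiff ℝ (⊤ : ℕ∞) F ∧
      ∀ r θ, f r θ = Real.exp r * F (Real.exp (-2 * r), θ) := by
  obtain ⟨a, b, ha, hb, h⟩ := hf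
  have ha := ha.1
  have hb := hb.1
  refine ⟨fun p => (a p.2 + b p.2) / 2 + (a p.2 - b p.2) / 2 * p.1, by fun_prop, fun r θ => ?_⟩
  have : Real.exp (-r) = Real.exp r * Real.exp (-2 * r) := by
    rw [← Real.exp_add]; congr 1; ring
  rw [h, Real.cosh_eq, Real.sinh_eq, this]
  ring

/-- Lower bounds extend to the closed rectangle. -/
lemma ext_lb {r₀ ε : ℝ} {P : ℝ × ℝ → ℝ} (hP : Continuous P)
    (h : ∀ r θ, r₀ < r → -Real.pi < θ → θ < Real.pi → ε ≤ P (Real.exp (-2 * r), θ)) :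
    ∀ p : ℝ × ℝ, p.1 ∈ Set.Icc 0 (Real.exp (-2 * r₀)) → p.2 ∈ Set.Icc (-Real.pi) Real.pi →
      ε ≤ P p := by
  intro p h1 h2
  have hcl : IsClosed {p | ε ≤ P p} := isClosed_le continuous_const hP
  have hsub : Set.Ioo 0 (Real.exp (-2 * r₀)) ×ˢ Set.Ioo (-Real.pi) Real.pi ⊆ {p | ε ≤ P p} := by
    rintro ⟨x, θ⟩ ⟨hx, hθ⟩
    have := h (-(Real.log x) / 2) θ (by
      have := (Real.log_lt_iff_lt_exp hx.1).2 hx.2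
      linarith) hθ.1 hθ.2
    rw [show -2 * (-(Real.log x) / 2) = Real.log x by ring, Real.exp_log hx.1] at this
    exact this
  have h3 := closure_minimal hsub hcl
  rw [closure_prod_eq, closure_Ioo (Real.exp_pos _).ne, closure_Ioo (by linarith [Real.pi_pos])] at h3
  exact h3 ⟨h1, h2⟩

/-- Decay estimates for algebraic combinations of functions of the
form `a(θ) cosh r + b(θ) sinh r` on `(r₀,∞) × (-π,π)`, under the lower bounds
`f ≥ C > 1`, `f ≥ ε e^r`, `h² + g² ≥ ε e^{2r}`. -/
theorem statement17 (r₀ : ℝ) (hr₀ : 0 < r₀)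
    (f g h w : ℝ → ℝ → ℝ)
    (hf : ∃ a b : ℝ → ℝ, BddSmooth a ∧ BddSmooth b ∧
      ∀ r θ, f r θ = a θ * Real.cosh r + b θ * Real.sinh r)
    (hg : ∃ a b : ℝ → ℝ, BddSmooth a ∧ BddSmooth b ∧
      ∀ r θ, g r θ = a θ * Real.cosh r + b θ * Real.sinh r)
    (hh : ∃ a b : ℝ → ℝ, BddSmooth a ∧ BddSmooth b ∧
      ∀ r θ, h r θ = a θ * Real.cosh r + b θ * Real.sinh r)
    (hw : ∃ a b : ℝ → ℝ, BddSmooth a ∧ BddSmooth b ∧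
      ∀ r θ, w r θ = a θ * Real.cosh r + b θ * Real.sinh r)
    (ε C : ℝ) (hε : 0 < ε) (hC : 1 < C)
    (hfC : ∀ r θ, r₀ < r → -Real.pi < θ → θ < Real.pi → C ≤ f r θ)
    (hfe : ∀ r θ, r₀ < r → -Real.pi < θ → θ < Real.pi → ε * Real.exp r ≤ f r θ)
    (hhg : ∀ r θ, r₀ < r → -Real.pi < θ → θ < Real.pi →
      ε * Real.exp (2 * r) ≤ h r θ ^ 2 + g r θ ^ 2) :
    -- (i) decay of the three kinds of quotients
    ((∀ α β : ℕ, ∃ C' > 0, ∀ r θ, r₀ < r → -Real.pi < θ → θ < Real.pi →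
        |pd2 α β (fun r' θ' => w r' θ' / (h r' θ' ^ 2 + g r' θ' ^ 2) ^ ((3 : ℝ) / 2)) r θ|
          ≤ C' * Real.exp (-2 * r)) ∧
      (∀ α β : ℕ, ∃ C' > 0, ∀ r θ, r₀ < r → -Real.pi < θ → θ < Real.pi →
        |pd2 α β (fun r' θ' => w r' θ' / (f r' θ' ^ 2 - 1) ^ ((3 : ℝ) / 2)) r θ|
          ≤ C' * Real.exp (-2 * r)) ∧
      (∀ bk : Fin 9 → ℝ → ℝ, (∀ k, BddSmooth (bk k)) →
        ∀ α β : ℕ, ∃ C' > 0, ∀ r θ, r₀ < r → -Real.pi < θ → θ < Real.pi →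
          |pd2 α β (fun r' θ' =>
              (∑ k : Fin 9, bk k θ' * Real.exp (((k : ℕ) - 4 : ℝ) * r')) /
                ((h r' θ' ^ 2 + g r' θ' ^ 2) * (1 + h r' θ' ^ 2 + g r' θ' ^ 2)) ^
                  ((3 : ℝ) / 2)) r θ|
            ≤ C' * Real.exp (-2 * r))) ∧
    -- (ii) the arcosh functions lie in `A_{P,1,r₀}`
    ((∀ α β : ℕ, α ≤ 1 → ∃ C' > 0, ∀ r θ, r₀ < r → -Real.pi < θ → θ < Real.pi →
        |pd2 α β (fun r' θ' => arcosh (Real.sqrt (1 + h r' θ' ^ 2 + g r' θ' ^ 2))) r θ|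
          ≤ C' * Real.sqrt (1 + r ^ 2) ^ ((1 : ℝ) - (α : ℝ))) ∧
      (∀ α β : ℕ, 2 ≤ α → ∃ C' > 0, ∀ r θ, r₀ < r → -Real.pi < θ → θ < Real.pi →
        |pd2 α β (fun r' θ' => arcosh (Real.sqrt (1 + h r' θ' ^ 2 + g r' θ' ^ 2))) r θ|
          ≤ C' * Real.exp (-2 * r)) ∧
      (∀ α β : ℕ, α ≤ 1 → ∃ C' > 0, ∀ r θ, r₀ < r → -Real.pi < θ → θ < Real.pi →
        |pd2 α β (fun r' θ' => arcosh (f r' θ')) r θ|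
          ≤ C' * Real.sqrt (1 + r ^ 2) ^ ((1 : ℝ) - (α : ℝ))) ∧
      (∀ α β : ℕ, 2 ≤ α → ∃ C' > 0, ∀ r θ, r₀ < r → -Real.pi < θ → θ < Real.pi →
        |pd2 α β (fun r' θ' => arcosh (f r' θ')) r θ| ≤ C' * Real.exp (-2 * r))) ∧
    -- (iii) the square-root quotients lie in `A_{P,0,r₀}`
    ((∀ β : ℕ, ∃ C' > 0, ∀ r θ, r₀ < r → -Real.pi < θ → θ < Real.pi →
        |pd2 0 β (fun r' θ' => w r' θ' / Real.sqrt (h r' θ' ^ 2 + g r' θ' ^ 2)) r θ| ≤ C') ∧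
      (∀ α β : ℕ, 1 ≤ α → ∃ C' > 0, ∀ r θ, r₀ < r → -Real.pi < θ → θ < Real.pi →
        |pd2 α β (fun r' θ' => w r' θ' / Real.sqrt (h r' θ' ^ 2 + g r' θ' ^ 2)) r θ|
          ≤ C' * Real.exp (-2 * r)) ∧
      (∀ β : ℕ, ∃ C' > 0, ∀ r θ, r₀ < r → -Real.pi < θ → θ < Real.pi →
        |pd2 0 β (fun r' θ' => w r' θ' / Real.sqrt (f r' θ' ^ 2 - 1)) r θ| ≤ C') ∧
      (∀ α β : ℕ, 1 ≤ α → ∃ C' > 0, ∀ r θ, r₀ < r → -Real.pi < θ → θ < Real.pi →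
        |pd2 α β (fun r' θ' => w r' θ' / Real.sqrt (f r' θ' ^ 2 - 1)) r θ|
          ≤ C' * Real.exp (-2 * r))) := by
  obtain ⟨F, hF, hfF⟩ := nf hf
  obtain ⟨G, hG, hgG⟩ := nf hg
  obtain ⟨H, hH, hhH⟩ := nf hh
  obtain ⟨W, hW, hwW⟩ := nf hw
  have hX : Real.exp (-r₀) ^ 2 ≤ Real.exp (-2 * r₀) := by
    rw [← Real.exp_nat_mul]; apply le_of_eq; congr 1; push_cast; ring
  have hx2 : ∀ r : ℝ, Real.exp (-r) ^ 2 = Real.exp (-2 * r) := by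
    intro r; rw [← Real.exp_nat_mul]; congr 1; push_cast; ring
  have hE2 : ∀ r : ℝ, Real.exp (2 * r) = Real.exp r ^ 2 := by
    intro r; rw [← Real.exp_nat_mul]; congr 1
  have hEE : ∀ r : ℝ, Real.exp r ^ 2 * Real.exp (-2 * r) = 1 := by
    intro r; rw [← hE2, ← Real.exp_add, ← Real.exp_zero]; congr 1; ring
  -- the reduced denominators
  obtain ⟨P, hPdef⟩ : ∃ P : ℝ × ℝ → ℝ, P = fun p => H p ^ 2 + G p ^ 2 := ⟨_, rfl⟩
  obtain ⟨Q, hQdef⟩ : ∃ Q : ℝ × ℝ → ℝ, Q = fun p => F p ^ 2 - p.1 := ⟨_, rfl⟩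
  have hP : ContDiff ℝ (⊤ : ℕ∞) P := by rw [hPdef]; fun_prop
  have hQ : ContDiff ℝ (⊤ : ℕ∞) Q := by rw [hQdef]; fun_prop
  have hhgP : ∀ r θ, h r θ ^ 2 + g r θ ^ 2 = Real.exp r ^ 2 * P (Real.exp (-2 * r), θ) := by
    intro r θ; rw [hhH, hgG, hPdef]; ring
  have hhgP1 : ∀ r θ, 1 + h r θ ^ 2 + g r θ ^ 2 =
      Real.exp r ^ 2 * (P (Real.exp (-2 * r), θ) + Real.exp (-2 * r)) := by
    intro r θ; rw [add_assoc, hhgP, mul_add, hEE]; ring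
  have hfQ : ∀ r θ, f r θ ^ 2 - 1 = Real.exp r ^ 2 * Q (Real.exp (-2 * r), θ) := by
    intro r θ; rw [hfF, hQdef]; simp only [mul_sub, hEE]; ring
  have hPlb : ∀ p : ℝ × ℝ, p.1 ∈ Set.Icc 0 (Real.exp (-2 * r₀)) →
      p.2 ∈ Set.Icc (-Real.pi) Real.pi → ε ≤ P p := by
    refine ext_lb hP.continuous (fun r θ hr h1 h2 => ?_)
    have := hhg r θ hr h1 h2
    rw [hhgP, hE2, mul_comm] at this
    exact le_of_mul_le_mul_left this (by positivity)
  have hFlb : ∀ p : ℝ × ℝ, p.1 ∈ Set.Icc 0 (Real.exp (-2 * r₀)) →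
      p.2 ∈ Set.Icc (-Real.pi) Real.pi → ε ≤ F p := by
    refine ext_lb hF.continuous (fun r θ hr h1 h2 => ?_)
    have := hfe r θ hr h1 h2
    rw [hfF, mul_comm] at this
    exact le_of_mul_le_mul_left this (by positivity)
  have hδ : 0 < (1 - 1 / C ^ 2) * ε ^ 2 := by
    have : 1 / C ^ 2 < 1 := by
      rw [div_lt_one (by positivity)]; nlinarith
    have : 0 < 1 - 1 / C ^ 2 := by linarith
    positivity
  have hQlb : ∀ p : ℝ × ℝ, p.1 ∈ Set.Icc 0 (Real.exp (-2 * r₀)) →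
      p.2 ∈ Set.Icc (-Real.pi) Real.pi → (1 - 1 / C ^ 2) * ε ^ 2 ≤ Q p := by
    refine ext_lb hQ.continuous (fun r θ hr h1 h2 => ?_)
    have e1 := hfe r θ hr h1 h2
    have e2 := hfC r θ hr h1 h2
    have e3 : 1 ≤ 1 / C ^ 2 * f r θ ^ 2 := by
      rw [one_div, inv_mul_eq_div, one_le_div (by positivity)]
      exact pow_le_pow_left₀ (by linarith) e2 2
    have e4 : (ε * Real.exp r) ^ 2 ≤ f r θ ^ 2 := pow_le_pow_left₀ (by positivity) e1 2
    have e5 : 0 ≤ 1 - 1 / C ^ 2 := by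
      by_contra hcon
      have := mul_neg_of_neg_of_pos (not_le.1 hcon) (show 0 < ε ^ 2 by positivity)
      linarith
    have e6 := hfQ r θ
    have e7 : Real.exp r ^ 2 * ((1 - 1 / C ^ 2) * ε ^ 2) ≤
        Real.exp r ^ 2 * Q (Real.exp (-2 * r), θ) := by
      rw [← e6]
      have := mul_le_mul_of_nonneg_left e4 e5
      nlinarith
    exact le_of_mul_le_mul_left e7 (by positivity)
  have hPpos : ∀ r θ, r₀ < r → -Real.pi < θ → θ < Real.pi → 0 < P (Real.exp (-2 * r), θ) :=
    fun r θ hr h1 h2 => hε.trans_le (hPlb (_, _) (expneg2_mem hr) ⟨h1.le, h2.le⟩)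
  have hQpos : ∀ r θ, r₀ < r → -Real.pi < θ → θ < Real.pi → 0 < Q (Real.exp (-2 * r), θ) :=
    fun r θ hr h1 h2 => hδ.trans_le (hQlb (_, _) (expneg2_mem hr) ⟨h1.le, h2.le⟩)
  have hFpos : ∀ r θ, r₀ < r → -Real.pi < θ → θ < Real.pi → 0 < F (Real.exp (-2 * r), θ) :=
    fun r θ hr h1 h2 => hε.trans_le (hFlb (_, _) (expneg2_mem hr) ⟨h1.le, h2.le⟩)
  -- powers of exponentials
  have hpow : ∀ (n : ℕ) (r : ℝ), (Real.exp r ^ (2 * n)) ^ ((3 : ℝ) / 2) = Real.exp r ^ (3 * n) := by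
    intro n r
    rw [← Real.exp_nat_mul, ← Real.exp_nat_mul, ← Real.exp_mul]
    congr 1; push_cast; ring
  -- the good functions
  have gP3 : Good (Real.exp (-2 * r₀)) (fun p => W p / P p ^ ((3 : ℝ) / 2)) := by
    intro p h1 h2
    have h0 := hε.trans_le (hPlb p h1 h2)
    exact hW.contDiffAt.div (hP.contDiffAt.rpow_const_of_ne h0.ne') (by positivity)
  have gQ3 : Good (Real.exp (-2 * r₀)) (fun p => W p / Q p ^ ((3 : ℝ) / 2)) := by
    intro p h1 h2
    have h0 := hδ.trans_le (hQlb p h1 h2)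
    exact hW.contDiffAt.div (hQ.contDiffAt.rpow_const_of_ne h0.ne') (by positivity)
  have gP1 : Good (Real.exp (-2 * r₀)) (fun p => W p / Real.sqrt (P p)) := by
    intro p h1 h2
    have h0 := hε.trans_le (hPlb p h1 h2)
    exact hW.contDiffAt.div (hP.contDiffAt.sqrt h0.ne') (by positivity)
  have gQ1 : Good (Real.exp (-2 * r₀)) (fun p => W p / Real.sqrt (Q p)) := by
    intro p h1 h2
    have h0 := hδ.trans_le (hQlb p h1 h2)
    exact hW.contDiffAt.div (hQ.contDiffAt.sqrt h0.ne') (by positivity)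
  have gPP : Good (Real.exp (-2 * r₀)) (fun p => (P p * (P p + p.1)) ^ ((3 : ℝ) / 2)) := by
    intro p h1 h2
    have h0 := hε.trans_le (hPlb p h1 h2)
    have h3 := h1.1
    exact (hP.contDiffAt.mul (hP.contDiffAt.add contDiffAt_fst)).rpow_const_of_ne (by positivity)
  have gL1 : Good (Real.exp (-2 * r₀))
      (fun p => Real.log (Real.sqrt (P p + p.1) + Real.sqrt (P p))) := by
    intro p h1 h2
    have h0 := hε.trans_le (hPlb p h1 h2)
    have h3 := h1.1
    exact (((hP.contDiffAt.add contDiffAt_fst).sqrt (by positivity)).add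
      (hP.contDiffAt.sqrt h0.ne')).log (by positivity)
  have gL2 : Good (Real.exp (-2 * r₀)) (fun p => Real.log (F p + Real.sqrt (Q p))) := by
    intro p h1 h2
    have h0 := hδ.trans_le (hQlb p h1 h2)
    have h3 := hε.trans_le (hFlb p h1 h2)
    exact (hF.contDiffAt.add (hQ.contDiffAt.sqrt h0.ne')).log (by positivity)
  -- the representations
  have key3 : ∀ (r : ℝ) (A B : ℝ), 0 < B →
      Real.exp r * A / (Real.exp r ^ 2 * B) ^ ((3 : ℝ) / 2) =
        Real.exp (-2 * r) * (A / B ^ ((3 : ℝ) / 2)) := by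
    intro r A B hB
    rw [Real.mul_rpow (by positivity) hB.le, hpow 1 r]
    have h6 : Real.exp (-2 * r) = 1 / Real.exp r ^ 2 := by
      rw [eq_div_iff (by positivity), mul_comm]; exact hEE r
    have hB' : 0 < B ^ ((3 : ℝ) / 2) := by positivity
    have hr' := Real.exp_pos r
    rw [h6]
    generalize B ^ ((3 : ℝ) / 2) = D at hB' ⊢
    field_simp
    ring
  have key1 : ∀ (r : ℝ) (A B : ℝ), 0 < B →
      Real.exp r * A / Real.sqrt (Real.exp r ^ 2 * B) = A / Real.sqrt B := by
    intro r A B hB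
    rw [Real.sqrt_mul (by positivity), Real.sqrt_sq (Real.exp_pos r).le,
      mul_div_mul_left _ _ (Real.exp_pos r).ne']
  have rL1 : ∀ r θ, r₀ < r → -Real.pi < θ → θ < Real.pi →
      arcosh (Real.sqrt (1 + h r θ ^ 2 + g r θ ^ 2)) = r +
        (fun p : ℝ × ℝ => Real.log (Real.sqrt (P p + p.1) + Real.sqrt (P p)))
          (Real.exp (-2 * r), θ) := by
    intro r θ hr h1 h2
    have h0 := hPpos r θ hr h1 h2
    have hx := Real.exp_pos (-2 * r)
    unfold arcosh
    rw [Real.sq_sqrt (by positivity), show 1 + h r θ ^ 2 + g r θ ^ 2 - 1 = h r θ ^ 2 + g r θ ^ 2 by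
      ring, hhgP1, hhgP, Real.sqrt_mul (by positivity), Real.sqrt_mul (by positivity),
      Real.sqrt_sq (Real.exp_pos r).le, ← mul_add, Real.log_mul (by positivity) (by positivity),
      Real.log_exp]
  have rL2 : ∀ r θ, r₀ < r → -Real.pi < θ → θ < Real.pi →
      arcosh (f r θ) = r +
        (fun p : ℝ × ℝ => Real.log (F p + Real.sqrt (Q p))) (Real.exp (-2 * r), θ) := by
    intro r θ hr h1 h2
    have h0 := hQpos r θ hr h1 h2
    have h3 := hFpos r θ hr h1 h2
    unfold arcosh
    rw [hfQ, Real.sqrt_mul (by positivity), Real.sqrt_sq (Real.exp_pos r).le, hfF,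
      ← mul_add, Real.log_mul (by positivity) (by positivity), Real.log_exp]
  have rP1 : ∀ r θ, r₀ < r → -Real.pi < θ → θ < Real.pi →
      w r θ / Real.sqrt (h r θ ^ 2 + g r θ ^ 2) =
        (fun p : ℝ × ℝ => W p / Real.sqrt (P p)) (Real.exp (-2 * r), θ) := by
    intro r θ hr h1 h2
    rw [hhgP, hwW, key1 _ _ _ (hPpos r θ hr h1 h2)]
  have rQ1 : ∀ r θ, r₀ < r → -Real.pi < θ → θ < Real.pi →
      w r θ / Real.sqrt (f r θ ^ 2 - 1) =
        (fun p : ℝ × ℝ => W p / Real.sqrt (Q p)) (Real.exp (-2 * r), θ) := by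
    intro r θ hr h1 h2
    rw [hfQ, hwW, key1 _ _ _ (hQpos r θ hr h1 h2)]
  refine ⟨⟨?_, ?_, ?_⟩, ⟨?_, ?_, ?_, ?_⟩, ⟨?_, ?_, ?_, ?_⟩⟩
  · refine E_bound (gP3.sq hX) (fun r θ hr h1 h2 => ?_)
    simp only [hx2]
    rw [hhgP, hwW, key3 _ _ _ (hPpos r θ hr h1 h2)]
  · refine E_bound (gQ3.sq hX) (fun r θ hr h1 h2 => ?_)
    simp only [hx2]
    rw [hfQ, hwW, key3 _ _ _ (hQpos r θ hr h1 h2)]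
  · intro bk hbk
    have gN : Good (Real.exp (-r₀)) (fun p => (∑ k : Fin 9, bk k p.2 * p.1 ^ (8 - (k : ℕ))) /
        (P (p.1 ^ 2, p.2) * (P (p.1 ^ 2, p.2) + p.1 ^ 2)) ^ ((3 : ℝ) / 2)) := by
      intro p h1 h2
      have hb : ∀ k, ContDiff ℝ (⊤ : ℕ∞) (bk k) := fun k => (hbk k).1
      have hs : ContDiff ℝ (⊤ : ℕ∞)
          (fun p : ℝ × ℝ => ∑ k : Fin 9, bk k p.2 * p.1 ^ (8 - (k : ℕ))) :=
        ContDiff.sum (fun k _ => ((hb k).comp contDiff_snd).mul (contDiff_fst.pow _))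
      have h0 : 0 < P (p.1 ^ 2, p.2) := hε.trans_le (hPlb (_, _) ⟨by positivity, by
        have := h1.1
        have := h1.2
        simp only
        nlinarith⟩ h2)
      exact hs.contDiffAt.div (gPP.sq hX p h1 h2) (by positivity)
    refine E_bound gN (fun r θ hr h1 h2 => ?_)
    have h0 := hPpos r θ hr h1 h2
    have hx := Real.exp_pos (-2 * r)
    simp only [hx2]
    have hnum : ∑ k : Fin 9, bk k θ * Real.exp (((k : ℕ) - 4 : ℝ) * r) =
        Real.exp r ^ 4 * ∑ k : Fin 9, bk k θ * Real.exp (-r) ^ (8 - (k : ℕ)) := by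
      rw [Finset.mul_sum]
      refine Finset.sum_congr rfl (fun k _ => ?_)
      have hk : (k : ℕ) ≤ 8 := by omega
      rw [← Real.exp_nat_mul, ← Real.exp_nat_mul, mul_left_comm, ← Real.exp_add]
      congr 2
      push_cast [Nat.cast_sub hk]
      ring
    rw [hnum, hhgP, hhgP1, show Real.exp r ^ 2 * P (Real.exp (-2 * r), θ) *
      (Real.exp r ^ 2 * (P (Real.exp (-2 * r), θ) + Real.exp (-2 * r))) = Real.exp r ^ (2 * 2) *
      (P (Real.exp (-2 * r), θ) * (P (Real.exp (-2 * r), θ) + Real.exp (-2 * r))) by ring,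
      Real.mul_rpow (by positivity) (by positivity), hpow 2 r]
    have hB : 0 < (P (Real.exp (-2 * r), θ) * (P (Real.exp (-2 * r), θ) + Real.exp (-2 * r))) ^
      ((3 : ℝ) / 2) := by positivity
    generalize (P (Real.exp (-2 * r), θ) * (P (Real.exp (-2 * r), θ) + Real.exp (-2 * r))) ^
      ((3 : ℝ) / 2) = B at hB ⊢
    generalize ∑ k : Fin 9, bk k θ * Real.exp (-r) ^ (8 - (k : ℕ)) = S
    have h6 : Real.exp (-2 * r) = 1 / Real.exp r ^ 2 := by
      rw [eq_div_iff (by positivity), mul_comm]; exact hEE r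
    rw [h6]
    have hr' := Real.exp_pos r
    field_simp
    ring
  · exact fun α β hα => S_boundJ hr₀ gL1 rL1 α β hα
  · exact fun α β hα => S_bound2 gL1 rL1 α β hα
  · exact fun α β hα => S_boundJ hr₀ gL2 rL2 α β hα
  · exact fun α β hα => S_bound2 gL2 rL2 α β hα
  · exact fun β => S_bound0 gP1 rP1 β
  · exact fun α β hα => S_bound1 gP1 rP1 α β hα
  · exact fun β => S_bound0 gQ1 rQ1 β
  · exact fun α β hα => S_bound1 gQ1 rQ1 α β hα
end
end
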